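/- arXiv:1705.05758 — 6 statements merged into one kernel-verified Lean document; each statement's English description precedes it below -/
import Mathlib

section
/- Let G be a finite simple graph of order n ≥ 7 that has a Hamiltonian path. Then D'(G) ≤ 2, i.e. G admits a distinguishing edge labeling with 2 labels. -/
/-- An edge labeling `f` of `G` with values in `Fin d` is *distinguishing* if the identity is the
only automorphism of `G` preserving it. -/
def SimpleGraph.IsDistinguishingEdgeLabeling {V : Type*} (G : SimpleGraph V) {d : ℕ}
    (f : G.edgeSet → Fin d) : Prop :=
  ∀ φ : G ≃g G, (∀ e : G.edgeSet, f (φ.mapEdgeSet e) = f e) → ∀ v : V, φ v = v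

/-- The distinguishing index `D'(G)`: the least number of labels in a distinguishing edge
labeling of `G`. -/
noncomputable def SimpleGraph.distinguishingIndex {V : Type*} (G : SimpleGraph V) : ℕ :=
  sInf {d : ℕ | ∃ f : G.edgeSet → Fin d, G.IsDistinguishingEdgeLabeling f}

namespace SimpleGraph

variable {V : Type*} {G : SimpleGraph V} {n : ℕ} {v : ℕ → V}

/-- `v` enumerates the vertices of `G` without repetition as `v 0, …, v (n - 1)`, consecutive
vertices being adjacent. -/
structure IsHamiltonianEnum (G : SimpleGraph V) (n : ℕ) (v : ℕ → V) : Prop where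
  inj : ∀ i < n, ∀ j < n, v i = v j → i = j
  surj : ∀ x, ∃ i < n, v i = x
  adj : ∀ i, i + 1 < n → G.Adj (v i) (v (i + 1))

/-- `π` permutes `{0, …, n - 1}` and preserves the relation `r` there. -/
structure IsIndexAut (n : ℕ) (r : ℕ → ℕ → Prop) (π : ℕ → ℕ) : Prop where
  lt : ∀ i < n, π i < n
  inj : ∀ i < n, ∀ j < n, π i = π j → i = j
  surj : ∀ j < n, ∃ i < n, π i = j
  rel : ∀ i < n, ∀ j < n, r (π i) (π j) ↔ r i j

/-- To bound the distinguishing index by two, it suffices to find a set of edges, given by a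
relation `r` on indices, that no nontrivial automorphism of `G` preserves. -/
lemma IsHamiltonianEnum.distinguishingIndex_le_two (hv : G.IsHamiltonianEnum n v)
    (r : ℕ → ℕ → Prop) (hsymm : ∀ i j, r i j → r j i)
    (hr : ∀ i < n, ∀ j < n, r i j → G.Adj (v i) (v j))
    (h : ∀ π, IsIndexAut n (fun i j ↦ G.Adj (v i) (v j)) π → IsIndexAut n r π →
      ∀ i < n, π i = i) :
    G.distinguishingIndex ≤ 2 := by
  classical
  let R : Sym2 V → Prop := fun e ↦ ∃ i j, i < n ∧ j < n ∧ r i j ∧ e = s(v i, v j)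
  have hR : ∀ i < n, ∀ j < n, (R s(v i, v j) ↔ r i j) := by
    intro i hi j hj
    constructor
    · rintro ⟨a, b, ha, hb, hab, he⟩
      rw [Sym2.eq_iff] at he
      rcases he with ⟨h1, h2⟩ | ⟨h1, h2⟩
      · rwa [hv.inj i hi a ha h1, hv.inj j hj b hb h2]
      · rw [hv.inj i hi b hb h1, hv.inj j hj a ha h2]
        exact hsymm _ _ hab
    · exact fun hij ↦ ⟨i, j, hi, hj, hij, rfl⟩
  refine Nat.sInf_le ⟨fun e ↦ if R e.1 then 1 else 0, fun φ hφ ↦ ?_⟩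
  choose ι hιlt hι using hv.surj
  let π : ℕ → ℕ := fun i ↦ ι (φ (v i))
  have hπ : ∀ i, v (π i) = φ (v i) := fun i ↦ hι _
  have hlt : ∀ i < n, π i < n := fun i _ ↦ hιlt _
  have hinj : ∀ i < n, ∀ j < n, π i = π j → i = j := fun i hi j hj hij ↦
    hv.inj i hi j hj (φ.injective (by rw [← hπ, ← hπ, hij]))
  have hsurj : ∀ j < n, ∃ i < n, π i = j := fun j hj ↦ by
    refine ⟨ι (φ.symm (v j)), hιlt _, hv.inj _ (hιlt _) _ hj ?_⟩
    rw [hπ, hι, φ.apply_symm_apply]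
  have hadj : ∀ i < n, ∀ j < n, G.Adj (v (π i)) (v (π j)) ↔ G.Adj (v i) (v j) := by
    intro i _ j _
    rw [hπ, hπ, φ.map_adj_iff]
  have hrel : ∀ i < n, ∀ j < n, r (π i) (π j) ↔ r i j := by
    intro i hi j hj
    by_cases hij : G.Adj (v i) (v j)
    · have := hφ ⟨s(v i, v j), hij⟩
      have h2 : R s(φ (v i), φ (v j)) ↔ R s(v i, v j) := by
        by_cases ha : R s(φ (v i), φ (v j)) <;> by_cases hb : R s(v i, v j) <;>
          simp_all [Iso.mapEdgeSet, Hom.mapEdgeSet]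
      rwa [← hπ, ← hπ, hR _ (hlt i hi) _ (hlt j hj), hR i hi j hj] at h2
    · exact iff_of_false
        (fun h' ↦ hij ((hadj i hi j hj).1 (hr _ (hlt i hi) _ (hlt j hj) h')))
        (fun h' ↦ hij (hr i hi j hj h'))
  intro x
  obtain ⟨i, hi, rfl⟩ := hv.surj x
  rw [← hπ, h π ⟨hlt, hinj, hsurj, hadj⟩ ⟨hlt, hinj, hsurj, hrel⟩ i hi]

/-- If the ends of a Hamiltonian path are not adjacent, the path without its first edge is
preserved by no nontrivial automorphism. -/
lemma IsHamiltonianEnum.distinguishingIndex_le_two_of_not_adj (hv : G.IsHamiltonianEnum n v)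
    (hn : 3 ≤ n) (hnadj : ¬ G.Adj (v 0) (v (n - 1))) : G.distinguishingIndex ≤ 2 := by
  refine hv.distinguishingIndex_le_two
    (fun i j ↦ 1 ≤ i ∧ 1 ≤ j ∧ (j = i + 1 ∨ i = j + 1)) (by grind) ?_ ?_
  · rintro i hi j hj ⟨-, -, rfl | rfl⟩
    · exact hv.adj i hj
    · exact (hv.adj j hi).symm
  · rintro π ⟨hlt, hinj, hsurj, hadj⟩ ⟨-, -, -, hrel⟩
    have h0 : π 0 = 0 := by
      by_contra hne
      have := hlt 0 (by lia)
      obtain ⟨m, hm, hm1, hm2⟩ : ∃ m < n, 1 ≤ m ∧ (m = π 0 + 1 ∨ π 0 = m + 1) := by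
        rcases Nat.lt_or_ge (π 0) 2 with h | h
        · exact ⟨2, by lia, by lia, by lia⟩
        · exact ⟨π 0 - 1, by lia, by lia, by lia⟩
      obtain ⟨k, hk, hkπ⟩ := hsurj m hm
      have := (hrel 0 (by lia) k hk).1 (by lia)
      lia
    have h1 : π 1 = 1 := by
      by_contra hne
      have h1lt := hlt 1 (by lia)
      have hpos : π 1 ≠ 0 := fun h ↦ by
        have := hinj 0 (by lia) 1 (by lia) (by lia)
        lia
      have hlast : π 1 ≠ n - 1 := fun h ↦ by
        have := (hadj 0 (by lia) 1 (by lia)).2 (hv.adj 0 (by lia))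
        rw [h0, h] at this
        exact hnadj this
      obtain ⟨k, hk, hkπ⟩ := hsurj (π 1 - 1) (by lia)
      obtain ⟨l, hl, hlπ⟩ := hsurj (π 1 + 1) (by lia)
      have hk2 := (hrel 1 (by lia) k hk).1 (by lia)
      have hl2 := (hrel 1 (by lia) l hl).1 (by lia)
      have : k = l := by lia
      subst this
      lia
    intro i
    induction i using Nat.strong_induction_on with
    | _ i ih =>
      intro hi
      rcases i with _ | _ | k
      · exact h0
      · exact h1
      · have := (hrel (k + 1) (by lia) (k + 2) hi).2 (by lia)
        have hk := ih k (by lia) (by lia)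
        have hk1 := ih (k + 1) (by lia) (by lia)
        have := hinj k (by lia) (k + 2) hi
        lia

/-- A Hamiltonian path together with a chord whose ends lie at distance `1` and at distance at
least `2` from the respective ends of the path is asymmetric. -/
lemma IsHamiltonianEnum.distinguishingIndex_le_two_of_chord (hv : G.IsHamiltonianEnum n v)
    {j : ℕ} (hj : 3 ≤ j) (hjn : j + 3 ≤ n) (hchord : G.Adj (v 1) (v j)) :
    G.distinguishingIndex ≤ 2 := by
  refine hv.distinguishingIndex_le_two
    (fun a b ↦ b = a + 1 ∨ a = b + 1 ∨ (a = 1 ∧ b = j) ∨ (a = j ∧ b = 1)) (by grind) ?_ ?_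
  · rintro a ha b hb (rfl | rfl | ⟨rfl, rfl⟩ | ⟨rfl, rfl⟩)
    · exact hv.adj a hb
    · exact (hv.adj b ha).symm
    · exact hchord
    · exact hchord.symm
  · rintro π - ⟨hlt, hinj, hsurj, hrel⟩
    have hleaf : ∀ i < n, (∀ a < n, ∀ b < n, (a = i + 1 ∨ i = a + 1 ∨ (i = 1 ∧ a = j) ∨
        (i = j ∧ a = 1)) → (b = i + 1 ∨ i = b + 1 ∨ (i = 1 ∧ b = j) ∨ (i = j ∧ b = 1)) →
        a = b) → π i = 0 ∨ π i = n - 1 := by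
      intro i hi hun
      by_contra hne
      have := hlt i hi
      obtain ⟨k, hk, hkπ⟩ := hsurj (π i - 1) (by lia)
      obtain ⟨l, hl, hlπ⟩ := hsurj (π i + 1) (by lia)
      have := hun k hk l hl ((hrel i hi k hk).1 (by lia)) ((hrel i hi l hl).1 (by lia))
      subst this
      lia
    have h0 := hleaf 0 (by lia) (by lia)
    have hlast := hleaf (n - 1) (by lia) (by lia)
    have h0' : π 0 = 0 := by
      by_contra hne
      have h0 : π 0 = n - 1 := by lia
      have h1 : π 1 = n - 2 := by
        have := (hrel 0 (by lia) 1 (by lia)).2 (by lia)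
        have := hlt 1 (by lia)
        lia
      have h2 := (hrel 1 (by lia) 2 (by lia)).2 (by lia)
      have hj' := (hrel 1 (by lia) j (by lia)).2 (by lia)
      have := hinj 0 (by lia) 2 (by lia)
      have := hinj 0 (by lia) j (by lia)
      have := hinj 2 (by lia) j (by lia)
      lia
    have hlast' : π (n - 1) = n - 1 := by
      have := hinj 0 (by lia) (n - 1) (by lia)
      lia
    have h1 : π 1 = 1 := by
      have := (hrel 0 (by lia) 1 (by lia)).2 (by lia)
      lia
    have key : ∀ k, k < n → ∀ l, l ≤ k → π (n - 1 - l) = n - 1 - l := by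
      intro k
      induction k with
      | zero =>
        intro _ l hl
        obtain rfl : l = 0 := by lia
        exact hlast'
      | succ k ih =>
        intro hk l hl
        rcases Nat.lt_or_ge l (k + 1) with hlk | hlk
        · exact ih (by lia) l (by lia)
        obtain rfl : l = k + 1 := by lia
        rcases Nat.lt_or_ge (k + 2) (n - 1) with hk2 | hk2
        · have hcur := ih (by lia) k le_rfl
          have hprev := ih (by lia) (k - 1) (by lia)
          have := (hrel (n - 1 - k) (by lia) (n - 1 - (k + 1)) (by lia)).2 (by lia)
          have := hlt (n - 1 - (k + 1)) (by lia)
          have := hinj (n - 1 - (k + 1)) (by lia) (n - 1 - (k - 1)) (by lia)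
          have := hinj (n - 1 - (k + 1)) (by lia) 1 (by lia)
          lia
        · have : n - 1 - (k + 1) = 0 ∨ n - 1 - (k + 1) = 1 := by lia
          rcases this with h | h <;> rw [h] <;> assumption
    intro i hi
    have := key (n - 1 - i) (by lia) _ le_rfl
    rwa [show n - 1 - (n - 1 - i) = i by lia] at this

/-- In a path or cycle on at least `7` vertices, the edges leaving `v 0`, `v 1` and `v 3` forwards
are preserved by no nontrivial automorphism. -/
lemma IsHamiltonianEnum.distinguishingIndex_le_two_of_chordless (hv : G.IsHamiltonianEnum n v)
    (hn : 7 ≤ n) (hchordless : ∀ i < n, ∀ j < n, G.Adj (v i) (v j) →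
      j = i + 1 ∨ i = j + 1 ∨ (i = 0 ∧ j = n - 1) ∨ (i = n - 1 ∧ j = 0)) :
    G.distinguishingIndex ≤ 2 := by
  refine hv.distinguishingIndex_le_two
    (fun a b ↦ (b = a + 1 ∧ (a = 0 ∨ a = 1 ∨ a = 3)) ∨
      (a = b + 1 ∧ (b = 0 ∨ b = 1 ∨ b = 3))) (by grind) ?_ ?_
  · rintro a ha b hb (⟨rfl, -⟩ | ⟨rfl, -⟩)
    · exact hv.adj a hb
    · exact (hv.adj b ha).symm
  · rintro π ⟨hlt, hinj, hsurj, hadj⟩ ⟨-, -, -, hrel⟩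
    have hstep : ∀ i, i + 1 < n → π (i + 1) = π i + 1 ∨ π i = π (i + 1) + 1 ∨
        (π i = 0 ∧ π (i + 1) = n - 1) ∨ (π i = n - 1 ∧ π (i + 1) = 0) := fun i hi ↦
      hchordless _ (hlt i (by lia)) _ (hlt (i + 1) hi)
        ((hadj i (by lia) (i + 1) hi).2 (hv.adj i hi))
    have h01 := (hrel 0 (by lia) 1 (by lia)).2 (by lia)
    have h12 := (hrel 1 (by lia) 2 (by lia)).2 (by lia)
    have h34 := (hrel 3 (by lia) 4 (by lia)).2 (by lia)
    have hne02 := hinj 0 (by lia) 2 (by lia)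
    have hne13 := hinj 1 (by lia) 3 (by lia)
    have h23 := hstep 2 (by lia)
    have h1 : π 1 = 1 := by lia
    have h0 : π 0 = 0 := by lia
    intro i
    induction i using Nat.strong_induction_on with
    | _ i ih =>
      intro hi
      rcases i with _ | _ | k
      · exact h0
      · exact h1
      · have := hstep (k + 1) (by lia)
        have hk := ih k (by lia) (by lia)
        have hk1 := ih (k + 1) (by lia) (by lia)
        have := hinj k (by lia) (k + 2) hi
        have := hlt (k + 2) hi
        lia

/-- A Hamiltonian cycle may be enumerated from any of its vertices. -/
lemma IsHamiltonianEnum.rotate (hv : G.IsHamiltonianEnum n v)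
    (hclose : G.Adj (v 0) (v (n - 1))) {s : ℕ} (hs : s < n) :
    G.IsHamiltonianEnum n
      (fun i ↦ v (if i + s < n then i + s else i + s - n)) where
  inj i hi j hj hij := by
    have := hv.inj _ (by split_ifs <;> lia) _ (by split_ifs <;> lia) hij
    split_ifs at this <;> lia
  surj x := by
    obtain ⟨k, hk, rfl⟩ := hv.surj x
    refine ⟨if s ≤ k then k - s else k + n - s, by split_ifs <;> lia, ?_⟩
    congr 1
    split_ifs <;> lia
  adj i hi := by
    rcases lt_trichotomy (i + 1 + s) n with h | h | h
    · rw [if_pos (by lia), if_pos h, show i + 1 + s = i + s + 1 by lia]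
      exact hv.adj _ (by lia)
    · rw [if_pos (by lia), if_neg (by lia), show i + 1 + s - n = 0 by lia,
        show i + s = n - 1 by lia]
      exact hclose.symm
    · rw [if_neg (by lia), if_neg (by lia), show i + 1 + s - n = i + s - n + 1 by lia]
      exact hv.adj _ (by lia)

lemma IsHamiltonianEnum.distinguishingIndex_le_two_of_seven_le (hv : G.IsHamiltonianEnum n v)
    (hn : 7 ≤ n) : G.distinguishingIndex ≤ 2 := by
  by_cases hclose : G.Adj (v 0) (v (n - 1))
  swap
  · exact hv.distinguishingIndex_le_two_of_not_adj (by lia) hclose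
  by_cases hchordless : ∀ i < n, ∀ j < n, G.Adj (v i) (v j) →
      j = i + 1 ∨ i = j + 1 ∨ (i = 0 ∧ j = n - 1) ∨ (i = n - 1 ∧ j = 0)
  · exact hv.distinguishingIndex_le_two_of_chordless hn hchordless
  push Not at hchordless
  obtain ⟨a, b, hlt, hb, hadj, hne⟩ : ∃ a b, a < b ∧ b < n ∧ G.Adj (v a) (v b) ∧
      b ≠ a + 1 ∧ ¬ (a = 0 ∧ b = n - 1) := by
    obtain ⟨a, ha, b, hb, hadj, hne⟩ := hchordless
    rcases lt_trichotomy a b with h | rfl | h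
    · exact ⟨a, b, h, hb, hadj, by lia⟩
    · exact absurd rfl hadj.ne
    · exact ⟨b, a, h, ha, hadj.symm, by lia⟩
  -- The shorter arc of the chord is placed inside the path.
  obtain ⟨c, d, j, hc, hd, hj, hjn, hcd, hdj⟩ : ∃ c d j, c < n ∧ d < n ∧ 3 ≤ j ∧ j + 3 ≤ n ∧
      G.Adj (v c) (v d) ∧ (d + 1 = c + j ∨ d + 1 + n = c + j) := by
    rcases Nat.lt_or_ge n (2 * (b - a)) with h | h
    · exact ⟨b, a, n - (b - a) + 1, hb, by lia, by lia, by lia, hadj.symm, by lia⟩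
    · exact ⟨a, b, b - a + 1, by lia, hb, by lia, by lia, hadj, by lia⟩
  have hs : (if c = 0 then n - 1 else c - 1) < n := by split_ifs <;> lia
  refine (hv.rotate hclose hs).distinguishingIndex_le_two_of_chord hj hjn ?_
  convert hcd using 2 <;> split_ifs <;> lia

end SimpleGraph

theorem distinguishingIndex_le_two_of_hamiltonianPath
    {V : Type*} [Fintype V] [DecidableEq V] (G : SimpleGraph V)
    (hcard : 7 ≤ Fintype.card V)
    (hham : ∃ (u v : V) (p : G.Walk u v), p.IsHamiltonian) :
    G.distinguishingIndex ≤ 2 := by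
  obtain ⟨u, w, p, hp⟩ := hham
  have hlen := hp.length_eq
  have hv : G.IsHamiltonianEnum (Fintype.card V) p.getVert := by
    refine ⟨fun i hi j hj hij ↦ ?_, fun x ↦ ?_, fun i hi ↦ p.adj_getVert_succ (by lia)⟩
    · exact hp.isPath.getVert_injOn (by simp; lia) (by simp; lia) hij
    · obtain ⟨i, rfl, hi⟩ := SimpleGraph.Walk.mem_support_iff_exists_getVert.1 (hp.mem_support x)
      exact ⟨i, by lia, rfl⟩
  exact hv.distinguishingIndex_le_two_of_seven_le hcard
end

section
/- Let p, q, r be integers with p ≥ 2, r ≥ 2 and (r−1)^p < q ≤ r^p. If q ≥ r^p − ⌈log_r p⌉ + 1, then the distinguishing index of the complete bipartite graph K_{p,q} equals r + 1. -/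
/-- An edge labeling of a complete bipartite graph, given by its matrix of labels. -/
def completeBipartiteLabeling {p q d : ℕ} (M : Fin p → Fin q → Fin (d + 1)) :
    (completeBipartiteGraph (Fin p) (Fin q)).edgeSet → Fin (d + 1) := fun e =>
  Sym2.lift ⟨fun a b => match a, b with
    | .inl i, .inr j => M i j
    | .inr j, .inl i => M i j
    | _, _ => 0, by rintro (a | a) (b | b) <;> rfl⟩ e.1

/-- The edge joining the `i`-th vertex of the first part to the `j`-th vertex of the second. -/
def completeBipartiteEdge {p q : ℕ} (i : Fin p) (j : Fin q) :
    (completeBipartiteGraph (Fin p) (Fin q)).edgeSet :=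
  ⟨s(.inl i, .inr j), by simp⟩

/-- The automorphism of a complete bipartite graph permuting each of the two parts. -/
def completeBipartiteIso {p q : ℕ} (σ : Equiv.Perm (Fin p)) (τ : Equiv.Perm (Fin q)) :
    completeBipartiteGraph (Fin p) (Fin q) ≃g completeBipartiteGraph (Fin p) (Fin q) where
  toEquiv := Equiv.sumCongr σ τ
  map_rel_iff' := by rintro (a | a) (b | b) <;> simp

lemma eq_one_of_isDistinguishingEdgeLabeling {p q d : ℕ}
    {f : (completeBipartiteGraph (Fin p) (Fin q)).edgeSet → Fin d}
    (hf : (completeBipartiteGraph (Fin p) (Fin q)).IsDistinguishingEdgeLabeling f)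
    (σ : Equiv.Perm (Fin p)) (τ : Equiv.Perm (Fin q))
    (h : ∀ i j, f (completeBipartiteEdge (σ i) (τ j)) = f (completeBipartiteEdge i j)) :
    σ = 1 ∧ τ = 1 := by
  have key := hf (completeBipartiteIso σ τ) (by
    rintro ⟨e, he⟩
    induction e using Sym2.ind with
    | _ a b =>
      rcases a with a | a <;> rcases b with b | b
      · simp at he
      · exact h a b
      · have hswap : (⟨s(.inr a, .inl b), he⟩ :
            (completeBipartiteGraph (Fin p) (Fin q)).edgeSet) = completeBipartiteEdge b a :=
          Subtype.ext Sym2.eq_swap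
        rw [hswap]
        exact h b a
      · simp at he)
  exact ⟨Equiv.ext fun i => Sum.inl_injective (key (.inl i)),
    Equiv.ext fun j => Sum.inr_injective (key (.inr j))⟩

lemma completeBipartiteGraph_iso_inl {p q : ℕ} (hpq : p < q)
    (φ : completeBipartiteGraph (Fin p) (Fin q) ≃g completeBipartiteGraph (Fin p) (Fin q))
    (i : Fin p) : ∃ i', φ (.inl i) = .inl i' := by
  rcases hi : φ (.inl i) with i' | j
  · exact ⟨i', rfl⟩
  have hleft : ∀ k : Fin q, ∃ l : Fin p, φ (.inr k) = .inl l := fun k => by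
    have hadj : (completeBipartiteGraph (Fin p) (Fin q)).Adj (φ (.inl i)) (φ (.inr k)) :=
      φ.map_adj_iff.2 (by simp)
    rcases hk : φ (.inr k) with l | l
    · exact ⟨l, rfl⟩
    · simp [hi, hk] at hadj
  choose g hg using hleft
  have hginj : Function.Injective g := fun a b hab =>
    Sum.inr_injective (φ.injective (by rw [hg, hg, hab]))
  have := Fintype.card_le_of_injective g hginj
  simp only [Fintype.card_fin] at this
  omega

lemma completeBipartiteGraph_iso_inr {p q : ℕ} (hpq : p < q)
    (φ : completeBipartiteGraph (Fin p) (Fin q) ≃g completeBipartiteGraph (Fin p) (Fin q))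
    (j : Fin q) : ∃ j', φ (.inr j) = .inr j' := by
  rcases hj : φ (.inr j) with i | j'
  · obtain ⟨i', hi'⟩ := completeBipartiteGraph_iso_inl hpq φ.symm i
    rw [← hj, RelIso.symm_apply_apply] at hi'
    cases hi'
  · exact ⟨j', rfl⟩

lemma isDistinguishingEdgeLabeling_completeBipartiteLabeling {p q d : ℕ} (hpq : p < q)
    (M : Fin p → Fin q → Fin (d + 1))
    (hM : ∀ (σ : Fin p → Fin p) (τ : Fin q → Fin q), Function.Bijective τ →
      (∀ i j, M (σ i) (τ j) = M i j) → (∀ i, σ i = i) ∧ ∀ j, τ j = j) :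
    (completeBipartiteGraph (Fin p) (Fin q)).IsDistinguishingEdgeLabeling
      (completeBipartiteLabeling M) := by
  intro φ hφ
  choose σ hσ using completeBipartiteGraph_iso_inl hpq φ
  choose τ hτ using completeBipartiteGraph_iso_inr hpq φ
  have hτinj : Function.Injective τ := fun a b hab =>
    Sum.inr_injective (φ.injective (by rw [hτ, hτ, hab]))
  obtain ⟨hσ1, hτ1⟩ := hM σ τ (Finite.injective_iff_bijective.1 hτinj) fun i j => by
    have himage : φ.mapEdgeSet (completeBipartiteEdge i j) =
        completeBipartiteEdge (σ i) (τ j) := by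
      apply Subtype.ext
      change s(φ (.inl i), φ (.inr j)) = s(.inl (σ i), .inr (τ j))
      rw [hσ, hτ]
    have hlabel := hφ (completeBipartiteEdge i j)
    rw [himage] at hlabel
    exact hlabel
  rintro (i | j)
  · rw [hσ, hσ1]
  · rw [hτ, hτ1]

/-- If few columns are missing, then some transposition of rows preserves the set of columns. -/
lemma exists_perm_ne_one_of_missing_columns {p q r k : ℕ} (hk : r ^ p = q + k) (hkp : r ^ k < p)
    (c : Fin q → Fin p → Fin r) (hc : Function.Injective c) :
    ∃ (σ : Equiv.Perm (Fin p)) (τ : Equiv.Perm (Fin q)), σ ≠ 1 ∧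
      ∀ i j, c (τ j) (σ i) = c j i := by
  classical
  have hcard : Fintype.card {v // v ∉ Set.range c} = k := by
    rw [Fintype.card_subtype_compl]
    have : Fintype.card {v // v ∈ Set.range c} = q := by
      exact (Set.card_range_of_injective hc).trans (Fintype.card_fin q)
    rw [this]
    simp [hk]
  obtain ⟨a, b, hab, hne⟩ : ∃ a b : Fin p,
      (fun v : {v // v ∉ Set.range c} => v.1 a) = (fun v => v.1 b) ∧ a ≠ b := by
    have := Fintype.exists_ne_map_eq_of_card_lt
      (fun (i : Fin p) (v : {v // v ∉ Set.range c}) => v.1 i)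
      (by rwa [Fintype.card_fun, hcard, Fintype.card_fin, Fintype.card_fin])
    obtain ⟨a, b, hne, hab⟩ := this
    exact ⟨a, b, hab, hne⟩
  have hmem : ∀ j, ∃ j', c j' = c j ∘ Equiv.swap a b := fun j => by
    by_contra hj
    have heq := congrFun hab ⟨c j ∘ Equiv.swap a b, hj⟩
    simp only [Function.comp_apply, Equiv.swap_apply_left, Equiv.swap_apply_right] at heq
    refine hj ⟨j, funext fun i => ?_⟩
    rw [Function.comp_apply, Equiv.swap_apply_def]
    split_ifs with h₁ h₂
    · rw [h₁, heq]
    · rw [h₂, heq]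
    · rfl
  choose τ hτ using hmem
  have hτinj : Function.Injective τ := fun x y hxy => hc <| by
    have : c x ∘ Equiv.swap a b = c y ∘ Equiv.swap a b := by rw [← hτ, ← hτ, hxy]
    exact (Equiv.swap a b).surjective.injective_comp_right this
  refine ⟨Equiv.swap a b, Equiv.ofBijective τ (Finite.injective_iff_bijective.1 hτinj), ?_, ?_⟩
  · simpa [Equiv.swap_eq_one_iff] using hne
  · intro i j
    simp [hτ]

lemma not_isDistinguishingEdgeLabeling_of_le {p q r k d : ℕ} (hk : r ^ p = q + k)
    (hkp : r ^ k < p) (hd : d ≤ r)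
    (f : (completeBipartiteGraph (Fin p) (Fin q)).edgeSet → Fin d) :
    ¬ (completeBipartiteGraph (Fin p) (Fin q)).IsDistinguishingEdgeLabeling f := by
  intro hf
  let c : Fin q → Fin p → Fin r := fun j i => Fin.castLE hd (f (completeBipartiteEdge i j))
  have hc : Function.Injective c := by
    intro x y hxy
    have hlabel : ∀ i, f (completeBipartiteEdge i x) = f (completeBipartiteEdge i y) :=
      fun i => Fin.castLE_injective hd (congrFun hxy i)
    have := (eq_one_of_isDistinguishingEdgeLabeling hf 1 (Equiv.swap x y) fun i j => by
      rw [Equiv.swap_apply_def, Equiv.Perm.one_apply]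
      split_ifs with h₁ h₂
      · rw [h₁, hlabel]
      · rw [h₂, hlabel]
      · rfl).2
    exact Equiv.swap_eq_one_iff.1 this
  obtain ⟨σ, τ, hσ, h⟩ := exists_perm_ne_one_of_missing_columns hk hkp c hc
  exact hσ (eq_one_of_isDistinguishingEdgeLabeling hf σ τ
    fun i j => Fin.castLE_injective hd (h i j)).1

/-- A label matrix whose first `p - 1` columns form a staircase of the label `r`, and whose other
columns are given by `e` and avoid the label `r`. -/
def staircaseMatrix {p q r : ℕ} (e : Fin q → Fin p → Fin r) (i : Fin p) (j : Fin q) :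
    Fin (r + 1) :=
  if j.1 + 1 < p then (if i.1 ≤ j.1 then Fin.last r else 0) else (e j i).castSucc

lemma staircaseMatrix_eq_last_iff {p q r : ℕ} (hr : r ≠ 0) (e : Fin q → Fin p → Fin r)
    (i : Fin p) (j : Fin q) :
    staircaseMatrix e i j = Fin.last r ↔ j.1 + 1 < p ∧ i.1 ≤ j.1 := by
  unfold staircaseMatrix
  split_ifs with h₁ h₂
  · simp [h₁, h₂]
  · simp [h₂, Fin.ext_iff, hr.symm]
  · simp [h₁, Fin.castSucc_ne_last]

lemma staircaseMatrix_column_injective {p q r : ℕ} (hp : p ≠ 0) (hr : r ≠ 0)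
    {e : Fin q → Fin p → Fin r} (he : Function.Injective e) {x y : Fin q}
    (h : ∀ i, staircaseMatrix e i x = staircaseMatrix e i y) : x = y := by
  have hiff : ∀ i : Fin p, (x.1 + 1 < p ∧ i.1 ≤ x.1) ↔ (y.1 + 1 < p ∧ i.1 ≤ y.1) := fun i => by
    rw [← staircaseMatrix_eq_last_iff hr e, ← staircaseMatrix_eq_last_iff hr e, h]
  have hzero := hiff ⟨0, by omega⟩
  by_cases hx : x.1 + 1 < p
  · have hy : y.1 + 1 < p := (hzero.1 ⟨hx, Nat.zero_le _⟩).1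
    have h₁ := hiff ⟨x.1, by omega⟩
    have h₂ := hiff ⟨y.1, by omega⟩
    simp only at h₁ h₂
    apply Fin.ext
    omega
  · have hy : ¬ y.1 + 1 < p := fun hy => hx (hzero.2 ⟨hy, Nat.zero_le _⟩).1
    refine he (funext fun i => ?_)
    have := h i
    simpa [staircaseMatrix, hx, hy] using this

lemma strictAnti_card_staircaseMatrix_eq_last {p q r : ℕ} (hpq : p < q) (hr : r ≠ 0)
    (e : Fin q → Fin p → Fin r) :
    StrictAnti fun i => (Finset.univ.filter fun j => staircaseMatrix e i j = Fin.last r).card := by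
  intro a b hab
  have hab' : a.1 < b.1 := hab
  apply Finset.card_lt_card
  simp only [staircaseMatrix_eq_last_iff hr]
  rw [Finset.ssubset_iff_of_subset]
  · refine ⟨⟨a.1, by omega⟩, ?_, ?_⟩ <;> simp <;> omega
  · intro j
    simp only [Finset.mem_filter, Finset.mem_univ, true_and]
    omega

lemma exists_isDistinguishingEdgeLabeling_completeBipartiteGraph {p q r : ℕ} (hp : p ≠ 0)
    (hr : r ≠ 0) (hpq : p < q) (hq : q ≤ r ^ p) :
    ∃ f : (completeBipartiteGraph (Fin p) (Fin q)).edgeSet → Fin (r + 1),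
      (completeBipartiteGraph (Fin p) (Fin q)).IsDistinguishingEdgeLabeling f := by
  obtain ⟨e⟩ : Nonempty (Fin q ↪ (Fin p → Fin r)) :=
    Function.Embedding.nonempty_of_card_le (by simpa using hq)
  refine ⟨_, isDistinguishingEdgeLabeling_completeBipartiteLabeling hpq (staircaseMatrix e) ?_⟩
  intro σ τ hτ h
  have hσ : ∀ i, σ i = i := fun i => by
    apply (strictAnti_card_staircaseMatrix_eq_last hpq hr e).injective
    symm
    refine Finset.card_bijective τ hτ fun j => ?_
    simp [h]
  refine ⟨hσ, fun j => staircaseMatrix_column_injective hp hr e.injective fun i => ?_⟩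
  rw [← h i j, hσ]

theorem distinguishingIndex_completeBipartiteGraph_eq_add_one
    (p q r : ℕ) (hp : 2 ≤ p) (hr : 2 ≤ r)
    (h1 : (r - 1) ^ p < q) (h2 : q ≤ r ^ p)
    (h3 : (r : ℤ) ^ p - ⌈Real.logb r p⌉ + 1 ≤ (q : ℤ)) :
    (completeBipartiteGraph (Fin p) (Fin q)).distinguishingIndex = r + 1 := by
  obtain ⟨k, hk⟩ := Nat.exists_eq_add_of_le h2
  have hkp : r ^ k < p := by
    have hceil : (k : ℤ) < ⌈Real.logb r p⌉ := by
      have : (r : ℤ) ^ p = q + k := by exact_mod_cast hk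
      omega
    have hlog : (k : ℝ) < Real.logb r p := by exact_mod_cast Int.lt_ceil.1 hceil
    have hr' : (1 : ℝ) < r := by exact_mod_cast hr
    have hp' : (0 : ℝ) < p := by positivity
    rw [Real.lt_logb_iff_rpow_lt hr' hp', Real.rpow_natCast] at hlog
    exact_mod_cast hlog
  have hpq : p < q := by
    have hlt : k < r ^ k := Nat.lt_pow_self hr
    have hpow : 2 ^ p ≤ r ^ p := Nat.pow_le_pow_left hr p
    obtain ⟨m, rfl⟩ : ∃ m, p = m + 1 := ⟨p - 1, by omega⟩
    have hm : m < 2 ^ m := Nat.lt_two_pow_self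
    rw [pow_succ 2] at hpow
    omega
  apply le_antisymm
  · exact Nat.sInf_le (exists_isDistinguishingEdgeLabeling_completeBipartiteGraph
      (by omega) (by omega) hpq h2)
  · refine le_csInf ⟨r + 1, exists_isDistinguishingEdgeLabeling_completeBipartiteGraph
      (by omega) (by omega) hpq h2⟩ ?_
    rintro d ⟨f, hf⟩
    by_contra hd
    exact not_isDistinguishingEdgeLabeling_of_le hk hkp (by omega) f hf
end

section
/- For every integer n ≥ 2, the distinguishing index of the friendship graph F_n equals ⌈(1/3)·a_n^(1/3) + 1/(3·a_n^(1/3)) + 1/3⌉, where a_n = 1 + 27n + 3·√(81n² + 6n). -/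
/-- The friendship graph `F_n`: `n` triangles glued at a common central vertex `none`.
The two outer vertices of the `i`-th triangle are `some (i, 0)` and `some (i, 1)`. -/
def friendshipGraph (n : ℕ) : SimpleGraph (Option (Fin n × Fin 2)) :=
  SimpleGraph.fromRel
    (fun u v => u = none ∨ ∃ x y : Fin n × Fin 2, u = some x ∧ v = some y ∧ x.1 = y.1)

namespace FriendshipGraph

variable {n d : ℕ}

/-- The other outer vertex of the triangle containing a given outer vertex. -/
def partner (x : Fin n × Fin 2) : Fin n × Fin 2 := (x.1, x.2.rev)

lemma partner_partner (x : Fin n × Fin 2) : partner (partner x) = x := by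
  simp [partner]

lemma partner_ne (x : Fin n × Fin 2) : partner x ≠ x := by
  obtain ⟨i, j⟩ := x
  fin_cases j <;> simp [partner]

lemma adj_none_some (x : Fin n × Fin 2) : (friendshipGraph n).Adj none (some x) := by
  simp [friendshipGraph, SimpleGraph.fromRel_adj]

lemma adj_some_some {x y : Fin n × Fin 2} :
    (friendshipGraph n).Adj (some x) (some y) ↔ y = partner x := by
  obtain ⟨i, j⟩ := x
  obtain ⟨k, l⟩ := y
  fin_cases j <;> fin_cases l <;>
    simp [friendshipGraph, SimpleGraph.fromRel_adj, partner] <;> grind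

/-- The edge joining the center to an outer vertex. -/
def spoke (x : Fin n × Fin 2) : (friendshipGraph n).edgeSet :=
  ⟨s(none, some x), adj_none_some x⟩

/-- The edge joining an outer vertex to its partner. -/
def rim (x : Fin n × Fin 2) : (friendshipGraph n).edgeSet :=
  ⟨s(some x, some (partner x)), adj_some_some.2 rfl⟩

lemma rim_partner (x : Fin n × Fin 2) : rim (partner x) = rim x := by
  apply Subtype.ext
  simp [rim, partner_partner, Sym2.eq_swap]

lemma edge_cases (e : (friendshipGraph n).edgeSet) : ∃ x, e = spoke x ∨ e = rim x := by
  obtain ⟨e, he⟩ := e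
  induction e with | h u v =>
  rw [SimpleGraph.mem_edgeSet] at he
  cases u with
  | none =>
    cases v with
    | none => exact absurd rfl he.ne
    | some y => exact ⟨y, Or.inl rfl⟩
  | some x =>
    cases v with
    | none => exact ⟨x, Or.inl (Subtype.ext Sym2.eq_swap)⟩
    | some y =>
      obtain rfl := adj_some_some.1 he
      exact ⟨x, Or.inr rfl⟩

/-- The labels seen from an outer vertex: on its own spoke, on the spoke of its partner, and on the
edge between the two. -/
def view (f : (friendshipGraph n).edgeSet → Fin d) (x : Fin n × Fin 2) : (Fin d × Fin d) × Fin d :=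
  ((f (spoke x), f (spoke (partner x))), f (rim x))

lemma view_partner (f : (friendshipGraph n).edgeSet → Fin d) (x : Fin n × Fin 2) :
    view f (partner x) = ((view f x).1.swap, (view f x).2) := by
  simp [view, partner_partner, rim_partner]

/-- The automorphism of the friendship graph induced by a permutation of the outer vertices
commuting with `partner`. -/
def extend (σ : Equiv.Perm (Fin n × Fin 2)) (hσ : ∀ x, σ (partner x) = partner (σ x)) :
    friendshipGraph n ≃g friendshipGraph n where
  toEquiv := σ.optionCongr
  map_rel_iff' := by
    intro u v
    cases u <;> cases v
    · simp
    · simp [adj_none_some]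
    · simp [(adj_none_some _).symm]
    · simp [adj_some_some, ← hσ]

/-- An automorphism of the friendship graph with at least two triangles fixes the center. -/
lemma apply_none (hn : 2 ≤ n) (φ : friendshipGraph n ≃g friendshipGraph n) : φ none = none := by
  by_contra h
  obtain ⟨x, hx⟩ := Option.ne_none_iff_exists'.1 h
  have : Nontrivial (Fin n) := Fin.nontrivial_iff_two_le.2 hn
  obtain ⟨i, hi⟩ := exists_ne x.1
  obtain ⟨v, hv⟩ := φ.surjective (some (i, 0))
  cases v with
  | none =>
    rw [hx, Option.some_inj] at hv
    exact hi (congrArg Prod.fst hv).symm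
  | some y =>
    have h1 := φ.map_adj_iff.2 (adj_none_some y)
    rw [hx, hv, adj_some_some] at h1
    exact hi (congrArg Prod.fst h1)

/-- The involution exchanging the outer vertices `x` and `y`, together with their partners. -/
def exchange (x y z : Fin n × Fin 2) : Fin n × Fin 2 :=
  if z = x then y else if z = y then x else
    if z = partner x then partner y else if z = partner y then partner x else z

lemma exchange_involutive (x y : Fin n × Fin 2) : Function.Involutive (exchange x y) := by
  intro z
  have := @partner_partner n
  have := @partner_ne n
  grind [exchange]

lemma exchange_partner (x y z : Fin n × Fin 2) :
    exchange x y (partner z) = partner (exchange x y z) := by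
  have := @partner_partner n
  have := @partner_ne n
  grind [exchange]

lemma view_exchange (f : (friendshipGraph n).edgeSet → Fin d) {x y : Fin n × Fin 2}
    (h : view f x = view f y) (z : Fin n × Fin 2) : view f (exchange x y z) = view f z := by
  have := view_partner f
  grind [exchange]

/-- A labeling of a friendship graph with at least two triangles is distinguishing exactly when
no two outer vertices see the same labels. -/
lemma isDistinguishing_iff_view_injective (hn : 2 ≤ n)
    (f : (friendshipGraph n).edgeSet → Fin d) :
    (friendshipGraph n).IsDistinguishingEdgeLabeling f ↔ Function.Injective (view f) := by
  constructor
  · intro hf x y hxy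
    have key := hf (extend (exchange_involutive x y).toPerm (exchange_partner x y)) (by
      intro e
      obtain ⟨z, rfl | rfl⟩ := edge_cases e
      · have : (extend (exchange_involutive x y).toPerm (exchange_partner x y)).mapEdgeSet (spoke z)
            = spoke (exchange x y z) := rfl
        rw [this]
        exact congrArg (fun t => t.1.1) (view_exchange f hxy z)
      · have : (extend (exchange_involutive x y).toPerm (exchange_partner x y)).mapEdgeSet (rim z)
            = rim (exchange x y z) := by
          apply Subtype.ext
          simp only [rim, ← exchange_partner]
          rfl
        rw [this]
        exact congrArg Prod.snd (view_exchange f hxy z)) (some x)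
    have h2 : some (exchange x y x) = some x := key
    simpa [exchange, eq_comm] using h2
  · intro hinj φ hφ v
    have h0 := apply_none hn φ
    have hsome : ∀ x, ∃ y, φ (some x) = some y := by
      intro x
      refine Option.ne_none_iff_exists'.1 fun h => ?_
      simpa using φ.injective (h.trans h0.symm)
    choose σ hσ using hsome
    have hpartner : ∀ x, σ (partner x) = partner (σ x) := by
      intro x
      rw [← adj_some_some, ← hσ, ← hσ, φ.map_adj_iff, adj_some_some]
    have hspoke : ∀ x, f (spoke (σ x)) = f (spoke x) := by
      intro x
      rw [← hφ (spoke x)]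
      congr 1
      apply Subtype.ext
      simp [spoke, h0, hσ]
    have hrim : ∀ x, f (rim (σ x)) = f (rim x) := by
      intro x
      rw [← hφ (rim x)]
      congr 1
      apply Subtype.ext
      simp [rim, hσ, hpartner]
    cases v with
    | none => exact h0
    | some x =>
      rw [hσ]
      congr 1
      apply hinj
      simp [view, hspoke, hrim, ← hpartner]

/-- The edge labeling with prescribed labels on spokes and on rims. -/
lemma exists_labeling (h : Fin n × Fin 2 → Fin d) (c : Fin n → Fin d) :
    ∃ f : (friendshipGraph n).edgeSet → Fin d,
      (∀ x, f (spoke x) = h x) ∧ ∀ x, f (rim x) = c x.1 := by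
  have hex : ∀ e : (friendshipGraph n).edgeSet, ∃ l : Fin d,
      (∀ x, e = spoke x → l = h x) ∧ ∀ x, e = rim x → l = c x.1 := by
    intro e
    obtain ⟨x, rfl | rfl⟩ := edge_cases e
    · refine ⟨h x, fun y hy => ?_, fun y hy => ?_⟩
      · have := congrArg Subtype.val hy
        simp [spoke] at this
        rw [this]
      · have := congrArg Subtype.val hy
        simp [spoke, rim] at this
    · refine ⟨c x.1, fun y hy => ?_, fun y hy => ?_⟩
      · have := congrArg Subtype.val hy
        simp [spoke, rim] at this
      · have := congrArg Subtype.val hy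
        simp only [rim, Sym2.eq_iff, Option.some_inj] at this
        obtain ⟨rfl, -⟩ | ⟨rfl, -⟩ := this <;> rfl
  choose f hf using hex
  exact ⟨f, fun x => (hf _).1 x rfl, fun x => (hf _).2 x rfl⟩

lemma two_mul_le_of_view_injective {f : (friendshipGraph n).edgeSet → Fin d}
    (hf : Function.Injective (view f)) : 2 * n ≤ (d * d - d) * d := by
  have hmem : ∀ x, view f x ∈ (Finset.univ : Finset (Fin d)).offDiag ×ˢ Finset.univ := by
    intro x
    simp only [Finset.mem_product, Finset.mem_offDiag, Finset.mem_univ, true_and, and_true]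
    intro h
    apply partner_ne x
    apply hf
    rw [view_partner]
    exact Prod.ext (Prod.ext h.symm h) rfl
  have := Finset.card_le_card_of_injOn (s := Finset.univ) (view f) (fun x _ => hmem x) hf.injOn
  simpa [Finset.offDiag_card, mul_comm] using this

lemma exists_view_injective (h : 2 * n ≤ (d * d - d) * d) :
    ∃ f : (friendshipGraph n).edgeSet → Fin d, Function.Injective (view f) := by
  have hcard : Fintype.card (Fin n) ≤
      Fintype.card ((Finset.powersetCard 2 (Finset.univ : Finset (Fin d))) × Fin d) := by
    have h2 : d.choose 2 * 2 = d * d - d := by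
      rw [← Finset.sum_range_id_mul_two d |>.trans (Nat.mul_sub_one d d),
        Finset.sum_range_id, Nat.choose_two_right]
    simp only [Fintype.card_prod, Fintype.card_coe, Finset.card_powersetCard, Fintype.card_fin,
      Finset.card_univ]
    rw [← h2] at h
    nlinarith
  obtain ⟨F⟩ := Function.Embedding.nonempty_of_card_le hcard
  have hpair : ∀ i, ∃ a b, a ≠ b ∧ (F i).1.1 = {a, b} := fun i =>
    Finset.card_eq_two.1 (Finset.mem_powersetCard.1 (F i).1.2).2
  choose a b hab hF using hpair
  obtain ⟨f, hs, hr⟩ := exists_labeling (fun x => if x.2 = 0 then a x.1 else b x.1)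
    (fun i => (F i).2)
  refine ⟨f, fun x y hxy => ?_⟩
  have hset : ∀ x, (F x.1).1.1 = {(view f x).1.1, (view f x).1.2} := by
    rintro ⟨i, j⟩
    rw [hF]
    fin_cases j
    · simp [view, hs, partner]
    · simp [view, hs, partner, Finset.pair_comm]
  have h1 : x.1 = y.1 := by
    apply F.injective
    refine Prod.ext (Subtype.ext ?_) ?_
    · rw [hset, hset, hxy]
    · simpa [view, hr] using congrArg Prod.snd hxy
  obtain ⟨i, j⟩ := x
  obtain ⟨k, l⟩ := y
  obtain rfl : i = k := h1
  have h2 := congrArg (fun t => t.1.1) hxy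
  simp only [view, hs] at h2
  fin_cases j <;> fin_cases l
  · rfl
  · exact absurd h2 (hab i)
  · exact absurd h2.symm (hab i)
  · rfl

/-- Cardano's formula for the real root of `x ^ 3 - x ^ 2 = 2 * t`. -/
lemma cardano_root {t : ℝ} (ht : 0 < t) {x : ℝ}
    (hx : x = (1 / 3 : ℝ) * (1 + 27 * t + 3 * Real.sqrt (81 * t ^ 2 + 6 * t)) ^ ((1 : ℝ) / 3)
        + 1 / (3 * (1 + 27 * t + 3 * Real.sqrt (81 * t ^ 2 + 6 * t)) ^ ((1 : ℝ) / 3))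
        + 1 / 3) : 0 < x ∧ x ^ 3 - x ^ 2 = 2 * t := by
  have hs := Real.sq_sqrt (show 0 ≤ 81 * t ^ 2 + 6 * t by positivity)
  have hs0 := Real.sqrt_nonneg (81 * t ^ 2 + 6 * t)
  set s := Real.sqrt (81 * t ^ 2 + 6 * t)
  have ha : 0 < 1 + 27 * t + 3 * s := by positivity
  have hu := Real.rpow_pos_of_pos ha ((1 : ℝ) / 3)
  have hu3 : ((1 + 27 * t + 3 * s) ^ ((1 : ℝ) / 3)) ^ 3 = 1 + 27 * t + 3 * s := by
    rw [← Real.rpow_natCast, ← Real.rpow_mul ha.le]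
    norm_num
  set u := (1 + 27 * t + 3 * s) ^ ((1 : ℝ) / 3)
  refine ⟨by rw [hx]; positivity, ?_⟩
  have hu6 : u ^ 6 + 1 = (54 * t + 2) * u ^ 3 := by
    rw [show u ^ 6 = (u ^ 3) ^ 2 by ring, hu3]
    linear_combination 9 * hs
  rw [hx]
  field_simp
  linear_combination hu6

lemma le_natCast_iff {t : ℕ} (ht : 0 < t) {x : ℝ} (hx : 0 < x) (h : x ^ 3 - x ^ 2 = 2 * t)
    (d : ℕ) : x ≤ d ↔ 2 * t ≤ (d * d - d) * d := by
  have ht' : (0 : ℝ) < t := by exact_mod_cast ht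
  have hx1 : 1 < x := by
    by_contra! hle
    nlinarith [sq_nonneg x]
  rcases Nat.eq_zero_or_pos d with rfl | hd
  · simp only [Nat.cast_zero, mul_zero]
    constructor
    · intro; linarith
    · intro; omega
  have hd1 : (1 : ℝ) ≤ d := by exact_mod_cast hd
  rw [← Nat.cast_le (α := ℝ)]
  push_cast [Nat.cast_sub (Nat.le_mul_self d)]
  rw [← h]
  have hfac : ((d : ℝ) * d - d) * d - (x ^ 3 - x ^ 2) =
      (d - x) * (d * (d - 1) + x * (x - 1) + d * x) := by ring
  have hpos : 0 < (d : ℝ) * (d - 1) + x * (x - 1) + d * x := by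
    have := mul_nonneg (zero_le_one.trans hd1) (sub_nonneg.2 hd1)
    have := mul_pos hx (sub_pos.2 hx1)
    positivity
  rw [← sub_nonneg, ← sub_nonneg (b := x ^ 3 - x ^ 2), hfac, mul_nonneg_iff_of_pos_right hpos]

end FriendshipGraph

open FriendshipGraph in
theorem distinguishingIndex_friendshipGraph (n : ℕ) (hn : 2 ≤ n) :
    (friendshipGraph n).distinguishingIndex =
      ⌈(1 / 3 : ℝ) * (1 + 27 * n + 3 * Real.sqrt (81 * n ^ 2 + 6 * n)) ^ ((1 : ℝ) / 3)
        + 1 / (3 * (1 + 27 * n + 3 * Real.sqrt (81 * n ^ 2 + 6 * n)) ^ ((1 : ℝ) / 3))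
        + 1 / 3⌉₊ := by
  have hn0 : 0 < n := by omega
  obtain ⟨hpos, hroot⟩ := cardano_root (t := n) (by exact_mod_cast hn0) rfl
  have hset : ∀ d : ℕ, (∃ f : (friendshipGraph n).edgeSet → Fin d,
      (friendshipGraph n).IsDistinguishingEdgeLabeling f) ↔ 2 * n ≤ (d * d - d) * d := by
    intro d
    simp only [isDistinguishing_iff_view_injective hn]
    exact ⟨fun ⟨_, hf⟩ => two_mul_le_of_view_injective hf, exists_view_injective⟩
  refine IsLeast.csInf_eq ⟨?_, fun d hd => ?_⟩
  · exact (hset _).2 ((le_natCast_iff hn0 hpos hroot _).1 (Nat.le_ceil _))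
  · exact Nat.ceil_le.2 ((le_natCast_iff hn0 hpos hroot d).2 ((hset d).1 hd))
end

section
/- For n ∈ {3, 4, 5}, the distinguishing index of the cycle C_n on n vertices equals 3. -/
namespace SimpleGraph

/-- The reflection `i ↦ c - i` of the cycle graph. -/
def cycleGraphReflection (n : ℕ) (c : Fin (n + 2)) :
    cycleGraph (n + 2) ≃g cycleGraph (n + 2) where
  toEquiv := Equiv.subLeft c
  map_rel_iff' {a b} := by
    simp only [cycleGraph_adj, Equiv.subLeft_apply, sub_sub_sub_cancel_left]
    exact or_comm

lemma exists_eq_of_mem_edgeSet_cycleGraph {n : ℕ} {e : Sym2 (Fin (n + 2))}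
    (he : e ∈ (cycleGraph (n + 2)).edgeSet) : ∃ i, e = s(i, i + 1) := by
  induction e with
  | _ u v =>
    rw [mem_edgeSet, cycleGraph_adj] at he
    rcases he with h | h
    · exact ⟨v, by rw [← h, add_sub_cancel, Sym2.eq_swap]⟩
    · exact ⟨u, by rw [← h, add_sub_cancel]⟩

/-- An automorphism of a cycle fixing two adjacent vertices is the identity. -/
lemma cycleGraph_iso_apply_eq_self {n : ℕ} (φ : cycleGraph (n + 2) ≃g cycleGraph (n + 2))
    (h0 : φ 0 = 0) (h1 : φ 1 = 1) (v : Fin (n + 2)) : φ v = v := by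
  suffices h : φ v = v ∧ φ (v + 1) = v + 1 from h.1
  induction v using Fin.induction with
  | zero => simpa using ⟨h0, h1⟩
  | succ k ih =>
    obtain ⟨hk, hk1⟩ := ih
    rw [Fin.coeSucc_eq_succ] at hk1
    refine ⟨hk1, ?_⟩
    have hadj : (cycleGraph (n + 2)).Adj k.succ (k.succ + 1) := by
      simp [cycleGraph_adj]
    rw [← φ.map_adj_iff, hk1, cycleGraph_adj] at hadj
    rcases hadj with h | h
    · have hφ : φ (k.succ + 1) = k.castSucc := by
        rw [sub_eq_iff_eq_add, ← Fin.coeSucc_eq_succ, add_comm 1, add_right_cancel_iff] at h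
        rw [← Fin.coeSucc_eq_succ]
        exact h.symm
      rw [hφ, φ.injective (hφ.trans hk.symm)]
    · rw [sub_eq_iff_eq_add] at h
      rw [h, add_comm 1]

/-- If every two-labeling of `Fin (n + 3)` is preserved by a reflection, then two labels do not
suffice to distinguish the edges of the cycle on `n + 3` vertices. -/
lemma not_isDistinguishingEdgeLabeling_cycleGraph {n d : ℕ} (hd : d ≤ 2)
    (h : ∀ g : Fin (n + 3) → Fin 2, ∃ c, ∀ i, g (c - i) = g i)
    (f : (cycleGraph (n + 3)).edgeSet → Fin d) :
    ¬ (cycleGraph (n + 3)).IsDistinguishingEdgeLabeling f := by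
  intro hf
  have hadj (i : Fin (n + 3)) : s(i, i + 1) ∈ (cycleGraph (n + 3)).edgeSet := by
    simp [cycleGraph_adj]
  obtain ⟨c, hc⟩ := h fun i => Fin.castLE hd (f ⟨s(i, i + 1), hadj i⟩)
  have hfix := hf (cycleGraphReflection (n + 1) (c + 1)) <| by
    rintro ⟨e, he⟩
    obtain ⟨i, rfl⟩ := exists_eq_of_mem_edgeSet_cycleGraph he
    rw [← Fin.castLE_injective hd (hc i)]
    congr 1
    apply Subtype.ext
    change s(c + 1 - i, c + 1 - (i + 1)) = s(c - i, c - i + 1)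
    rw [Sym2.eq_swap, add_sub_add_right_eq_sub, sub_add_eq_add_sub]
  have h0 : c + 1 - 0 = 0 := hfix 0
  have h1 : c + 1 - 1 = 1 := hfix 1
  rw [add_sub_cancel_right] at h1
  rw [sub_zero, h1] at h0
  have := congrArg Fin.val h0
  simp [Fin.val_add, Nat.mod_eq_of_lt] at this

/-- Three labels suffice to distinguish the edges of a cycle. -/
lemma exists_isDistinguishingEdgeLabeling_cycleGraph (n : ℕ) :
    ∃ f : (cycleGraph (n + 3)).edgeSet → Fin 3,
      (cycleGraph (n + 3)).IsDistinguishingEdgeLabeling f := by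
  have h01 : (0 : Fin (n + 3)) ≠ 1 := by simp
  have h02 : (0 : Fin (n + 3)) ≠ 2 := by simp [Fin.ext_iff, Nat.mod_eq_of_lt]
  have h12 : (1 : Fin (n + 3)) ≠ 2 := by simp [Fin.ext_iff, Nat.mod_eq_of_lt]
  let f : Sym2 (Fin (n + 3)) → Fin 3 := fun e =>
    if e = s(0, 1) then 0 else if e = s(1, 2) then 1 else 2
  refine ⟨fun e => f e, fun φ hφ => ?_⟩
  have ha : s(φ 0, φ 1) = s(0, 1) := by
    have : f s(φ 0, φ 1) = f s(0, 1) := hφ ⟨s(0, 1), by simp [cycleGraph_adj]⟩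
    grind
  have hb : s(φ 1, φ 2) = s(1, 2) := by
    have : f s(φ 1, φ 2) = f s(1, 2) := hφ ⟨s(1, 2), by
      rw [mem_edgeSet, cycleGraph_adj]
      right
      simp [sub_eq_iff_eq_add, Fin.ext_iff, Fin.val_add]⟩
    grind
  have h1 : φ 1 = 1 := by grind
  have h0 : φ 0 = 0 := by grind
  exact cycleGraph_iso_apply_eq_self φ h0 h1

lemma distinguishingIndex_cycleGraph_eq_three {n : ℕ}
    (h : ∀ g : Fin (n + 3) → Fin 2, ∃ c, ∀ i, g (c - i) = g i) :
    (cycleGraph (n + 3)).distinguishingIndex = 3 := by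
  have hmem := exists_isDistinguishingEdgeLabeling_cycleGraph n
  refine le_antisymm (Nat.sInf_le hmem) (le_csInf ⟨3, hmem⟩ ?_)
  rintro d ⟨f, hf⟩
  by_contra hd
  exact not_isDistinguishingEdgeLabeling_cycleGraph (by omega) h f hf

end SimpleGraph

theorem distinguishingIndex_cycleGraph_of_le_five (n : ℕ) (hn : n = 3 ∨ n = 4 ∨ n = 5) :
    (SimpleGraph.cycleGraph n).distinguishingIndex = 3 := by
  rcases hn with rfl | rfl | rfl <;>
    exact SimpleGraph.distinguishingIndex_cycleGraph_eq_three (by decide)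
end

section
/- Let G be a finite connected simple graph of order n ≥ 3 with maximum degree Δ, and suppose G is not isomorphic to any of the cycles C₃, C₄, C₅. Then D'(G) ≤ Δ. -/
namespace SimpleGraph

section

variable {V : Type*} {G : SimpleGraph V}

/-- A natural-number labeling of unordered pairs that is distinguishing on the edges and takes
values below `d` there bounds the distinguishing index by `d`. -/
lemma distinguishingIndex_le_of_labeling {d : ℕ} (l : Sym2 V → ℕ)
    (hl : ∀ e ∈ G.edgeSet, l e < d)
    (h : ∀ φ : G ≃g G, (∀ u v, G.Adj u v → l s(φ u, φ v) = l s(u, v)) → ∀ v, φ v = v) :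
    G.distinguishingIndex ≤ d := by
  refine Nat.sInf_le ⟨fun e => ⟨l e, hl e e.2⟩, fun φ hφ => h φ fun u v huv => ?_⟩
  exact congrArg Fin.val (hφ ⟨s(u, v), huv⟩)

lemma Connected.mem_of_closed (hconn : G.Connected) {S : Set V} {s : V} (hs : s ∈ S)
    (hS : ∀ u ∈ S, ∀ v, G.Adj u v → v ∈ S) (v : V) : v ∈ S := by
  obtain ⟨p⟩ := hconn.preconnected s v
  induction p with
  | nil => exact hs
  | cons hadj _ ih => exact ih (hS _ hs _ hadj)

/-- In a connected graph, the distance to a nonempty set `S` vanishes exactly on `S`, and every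
vertex outside `S` has a neighbor closer to `S`. -/
lemma Connected.exists_height (hconn : G.Connected) {S : Set V} (hS : S.Nonempty) :
    ∃ h : V → ℕ, (∀ v, h v = 0 ↔ v ∈ S) ∧ ∀ w, h w ≠ 0 → ∃ u, G.Adj u w ∧ h u < h w := by
  have hne : ∀ w, ((fun s => G.dist w s) '' S).Nonempty := fun w => hS.image _
  refine ⟨fun w => sInf ((fun s => G.dist w s) '' S), fun v => ⟨fun hv => ?_, fun hv => ?_⟩,
    fun w hw => ?_⟩
  · obtain ⟨s, hs, hd⟩ := Nat.sInf_mem (hne v)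
    have : G.dist v s = 0 := hd.trans hv
    rwa [(hconn.dist_eq_zero_iff).1 this]
  · exact Nat.le_zero.1 (Nat.sInf_le ⟨v, hv, by simp⟩)
  · obtain ⟨s, hs, hd⟩ := Nat.sInf_mem (hne w)
    obtain ⟨p, hp⟩ := hconn.exists_walk_length_eq_dist w s
    cases p with
    | nil =>
      refine absurd ?_ hw
      exact hd.symm.trans (by simp)
    | cons hadj q =>
      rename_i u
      refine ⟨u, hadj.symm, ?_⟩
      have h1 : sInf ((fun s => G.dist u s) '' S) ≤ G.dist u s := Nat.sInf_le ⟨s, hs, rfl⟩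
      have h2 := dist_le q
      rw [Walk.length_cons] at hp
      simp only at hd ⊢
      omega

/-- An automorphism preserving `l` that fixes all vertices of height zero is the identity, if
`l` separates the upward edges at each vertex. -/
lemma eq_self_of_height {l : Sym2 V → ℕ} {h : V → ℕ}
    (hpar : ∀ w, h w ≠ 0 → ∃ u, G.Adj u w ∧ h u < h w)
    (hinj : ∀ u w w', G.Adj u w → G.Adj u w' → h u < h w → h u < h w' →
      l s(u, w) = l s(u, w') → w = w')
    {φ : G ≃g G} (hφ : ∀ u v, G.Adj u v → l s(φ u, φ v) = l s(u, v))
    (hroot : ∀ v, h v = 0 → φ v = v) (v : V) : φ v = v := by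
  suffices H : ∀ k v, h v ≤ k → φ v = v from H _ v le_rfl
  intro k
  induction k with
  | zero => exact fun v hv => hroot v (Nat.le_zero.1 hv)
  | succ k ih =>
    intro w hw
    by_cases hk : h w ≤ k
    · exact ih w hk
    obtain ⟨u, huw, hlt⟩ := hpar w (by omega)
    have hu : φ u = u := ih u (by omega)
    by_cases hk' : h (φ w) ≤ k
    · exact φ.injective (ih _ hk')
    have hadj : G.Adj u (φ w) := by
      have := φ.map_adj_iff.2 huw
      rwa [hu] at this
    have hlab := hφ u w huw
    rw [hu] at hlab
    exact hinj u _ _ hadj huw (by omega) hlt hlab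

end

section

variable {V : Type*} [Fintype V] {G : SimpleGraph V}

open Classical in
/-- The neighbors of `u` of greater height than `u`, reached by edges outside `Z`. -/
noncomputable def upNeighbors (G : SimpleGraph V) (h : V → ℕ) (Z : Set (Sym2 V)) (u : V) :
    Finset V :=
  {w | G.Adj u w ∧ h u < h w ∧ s(u, w) ∉ Z}

lemma mem_upNeighbors {h : V → ℕ} {Z : Set (Sym2 V)} {u w : V} :
    w ∈ G.upNeighbors h Z u ↔ G.Adj u w ∧ h u < h w ∧ s(u, w) ∉ Z := by
  simp [upNeighbors]

/-- There is a labeling with values below `d` vanishing exactly on `Z` and labeling the upward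
edges at each `u` outside `Z` injectively by elements of `A u`. -/
lemma exists_labeling {d : ℕ} (hd : 2 ≤ d) (h : V → ℕ) (Z : Set (Sym2 V)) (A : V → Finset ℕ)
    (hA : ∀ u, A u ⊆ Finset.Icc 1 (d - 1))
    (hcard : ∀ u, (G.upNeighbors h Z u).card ≤ (A u).card) :
    ∃ l : Sym2 V → ℕ, (∀ e ∈ G.edgeSet, l e < d) ∧
      (∀ u v, G.Adj u v → (l s(u, v) = 0 ↔ s(u, v) ∈ Z)) ∧
      (∀ u, Set.InjOn (fun w => l s(u, w)) (G.upNeighbors h Z u)) ∧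
      ∀ u, ∀ w ∈ G.upNeighbors h Z u, l s(u, w) ∈ A u := by
  classical
  have hex : ∀ u, ∃ f : V → ℕ, (∀ w ∈ G.upNeighbors h Z u, f w ∈ A u) ∧
      Set.InjOn f (G.upNeighbors h Z u) := by
    intro u
    have hne : (A u : Set ℕ).encard ≥ (G.upNeighbors h Z u : Set V).encard := by
      simpa using hcard u
    obtain ⟨f, hf, hi⟩ := (Finset.finite_toSet _).exists_injOn_of_encard_le hne
    exact ⟨f, fun w hw => by simpa using hf hw, hi⟩
  choose c hcA hcinj using hex
  let l : Sym2 V → ℕ := Sym2.lift ⟨fun u w => if s(u, w) ∈ Z then 0 else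
    if h u < h w then c u w else if h w < h u then c w u else 1, by
      intro u w
      simp only [Sym2.eq_swap (a := u) (b := w)]
      split_ifs <;> first | rfl | omega⟩
  have hl : ∀ u w, l s(u, w) = if s(u, w) ∈ Z then 0 else
    if h u < h w then c u w else if h w < h u then c w u else 1 := fun u w => rfl
  have hup : ∀ u, ∀ w ∈ G.upNeighbors h Z u, l s(u, w) = c u w := by
    intro u w hw
    rw [mem_upNeighbors] at hw
    rw [hl, if_neg hw.2.2, if_pos hw.2.1]
  have hrange : ∀ u w, G.Adj u w → h u < h w → s(u, w) ∉ Z → 1 ≤ c u w ∧ c u w ≤ d - 1 :=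
    fun u w h1 h2 h3 => Finset.mem_Icc.1 (hA u (hcA u w (mem_upNeighbors.2 ⟨h1, h2, h3⟩)))
  refine ⟨l, ?_, ?_, ?_, ?_⟩
  · intro e
    induction e with | _ u w => ?_
    intro hadj
    rw [mem_edgeSet] at hadj
    have h1 := hrange u w hadj
    have h2 := hrange w u hadj.symm
    rw [Sym2.eq_swap] at h2
    rw [hl]
    split_ifs with hz hlt hgt
    · omega
    · have := h1 hlt hz; omega
    · have := h2 hgt hz; omega
    · omega
  · intro u w hadj
    have h1 := hrange u w hadj
    have h2 := hrange w u hadj.symm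
    rw [Sym2.eq_swap] at h2
    rw [hl]
    split_ifs with hz hlt hgt
    · simp [hz]
    · have := h1 hlt hz; simp only [hz, iff_false]; omega
    · have := h2 hgt hz; simp only [hz, iff_false]; omega
    · simp [hz]
  · intro u w hw w' hw' heq
    simp only at heq
    rw [hup u w hw, hup u w' hw'] at heq
    exact hcinj u hw hw' heq
  · intro u w hw
    rw [hup u w hw]
    exact hcA u w hw

end

section

variable {V : Type*} [Fintype V] {G : SimpleGraph V} [DecidableRel G.Adj]

lemma card_upNeighbors_lt (h : V → ℕ) (Z : Set (Sym2 V)) {u p : V} (hup : G.Adj u p)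
    (hp : h p ≤ h u ∨ s(u, p) ∈ Z) : (G.upNeighbors h Z u).card < G.degree u := by
  classical
  rw [← card_neighborFinset_eq_degree]
  refine Finset.card_lt_card ⟨fun w hw => ?_, fun hsub => ?_⟩
  · rw [mem_neighborFinset]
    exact (mem_upNeighbors.1 hw).1
  · have := mem_upNeighbors.1 (hsub ((G.mem_neighborFinset u p).2 hup))
    rcases hp with hp | hp
    · omega
    · exact this.2.2 hp

lemma Connected.two_le_maxDegree (hconn : G.Connected) (hn : 3 ≤ Fintype.card V) :
    2 ≤ G.maxDegree := by
  classical
  by_contra! hlt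
  have hdeg : ∀ v, G.degree v ≤ 1 := fun v => (G.degree_le_maxDegree v).trans (by omega)
  have : Nontrivial V := Fintype.one_lt_card_iff_nontrivial.1 (by omega)
  obtain ⟨b⟩ := hconn.nonempty
  obtain ⟨c, hbc⟩ := hconn.preconnected.exists_adj_of_nontrivial b
  have huniq : ∀ u v w, G.Adj u v → G.Adj u w → v = w := by
    intro u v w hv hw
    have := hdeg u
    rw [← card_neighborFinset_eq_degree, Finset.card_le_one] at this
    exact this v (by simpa) w (by simpa)
  have hall := hconn.mem_of_closed (S := {b, c}) (s := b) (by simp) (by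
    rintro u (rfl | rfl) v huv
    · exact Or.inr (huniq _ _ _ huv hbc)
    · exact Or.inl (huniq _ _ _ huv hbc.symm))
  have : Fintype.card V ≤ ({b, c} : Finset V).card :=
    Finset.card_le_card fun v _ => by simpa using hall v
  have := Finset.card_le_two (a := b) (b := c)
  omega

/-- An edge between vertices of different degrees is the only edge labeled zero. -/
lemma Connected.distinguishingIndex_le_of_degree_ne (hconn : G.Connected) {b c : V}
    (hbc : G.Adj b c) (hne : G.degree b ≠ G.degree c) :
    G.distinguishingIndex ≤ G.maxDegree := by
  classical
  have hd : 2 ≤ G.maxDegree := by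
    have h1 := G.degree_pos_iff_exists_adj b |>.2 ⟨c, hbc⟩
    have h2 := G.degree_pos_iff_exists_adj c |>.2 ⟨b, hbc.symm⟩
    have := G.degree_le_maxDegree b
    have := G.degree_le_maxDegree c
    omega
  obtain ⟨h, h0, hpar⟩ := hconn.exists_height (S := {b, c}) ⟨b, by simp⟩
  have hb : h b = 0 := (h0 b).2 (by simp)
  have hc : h c = 0 := (h0 c).2 (by simp)
  have hcard : ∀ u, (G.upNeighbors h {s(b, c)} u).card ≤
      (Finset.Icc 1 (G.maxDegree - 1)).card := by
    intro u
    obtain ⟨p, hp, hle⟩ : ∃ p, G.Adj u p ∧ h p ≤ h u := by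
      by_cases hu : h u = 0
      · rcases (h0 u).1 hu with rfl | rfl
        · exact ⟨c, hbc, by omega⟩
        · exact ⟨b, hbc.symm, by omega⟩
      · obtain ⟨p, hp, hlt⟩ := hpar u hu
        exact ⟨p, hp.symm, hlt.le⟩
    have := card_upNeighbors_lt h {s(b, c)} hp (Or.inl hle)
    have := G.degree_le_maxDegree u
    rw [Nat.card_Icc]
    omega
  obtain ⟨l, hlt, hzero, hinj, -⟩ := exists_labeling hd h {s(b, c)} _ (fun _ => subset_rfl) hcard
  refine distinguishingIndex_le_of_labeling l hlt fun φ hφ => ?_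
  have hz : s(φ b, φ c) = s(b, c) := by
    have := (hzero _ _ (φ.map_adj_iff.2 hbc)).1 ((hφ b c hbc).trans ((hzero b c hbc).2 rfl))
    exact this
  have hdeg : G.degree (φ b) = G.degree b := φ.degree_eq b
  have hfix : φ b = b ∧ φ c = c := by
    rcases Sym2.eq_iff.1 hz with hz | hz
    · exact hz
    · rw [hz.1] at hdeg
      exact absurd hdeg.symm hne
  refine eq_self_of_height hpar (fun u w w' huw huw' hw hw' heq => ?_) hφ ?_
  · have hnot : ∀ x, h u < h x → s(u, x) ∉ ({s(b, c)} : Set (Sym2 V)) := by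
      intro x hx hmem
      rcases Sym2.eq_iff.1 (Set.mem_singleton_iff.1 hmem) with ⟨rfl, rfl⟩ | ⟨rfl, rfl⟩ <;> omega
    exact hinj u (mem_upNeighbors.2 ⟨huw, hw, hnot w hw⟩)
      (mem_upNeighbors.2 ⟨huw', hw', hnot w' hw'⟩) heq
  · intro v hv
    rcases (h0 v).1 hv with rfl | rfl
    · exact hfix.1
    · exact hfix.2

/-- In the regular case with degree at least three, the edges labeled zero form a path
`a, b, c, e`; label `1` is absent at `b` and present at `c`. -/
lemma Connected.distinguishingIndex_le_of_regular (hconn : G.Connected) {d : ℕ} (hd : 3 ≤ d)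
    (hreg : G.IsRegularOfDegree d) : G.distinguishingIndex ≤ d := by
  classical
  obtain ⟨b⟩ := hconn.nonempty
  have hN : ∀ v, (G.neighborFinset v).card = d := fun v => hreg v
  obtain ⟨c, hc⟩ : (G.neighborFinset b).Nonempty := Finset.card_pos.1 (by rw [hN]; omega)
  obtain ⟨a, ha⟩ : ((G.neighborFinset b).erase c).Nonempty := by
    refine Finset.card_pos.1 ?_
    have := Finset.pred_card_le_card_erase (s := G.neighborFinset b) (a := c)
    rw [hN] at this
    omega
  obtain ⟨e, he⟩ : (((G.neighborFinset c).erase b).erase a).Nonempty := by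
    refine Finset.card_pos.1 ?_
    have h1 := Finset.pred_card_le_card_erase (s := G.neighborFinset c) (a := b)
    have h2 := Finset.pred_card_le_card_erase (s := (G.neighborFinset c).erase b) (a := a)
    rw [hN] at h1
    omega
  simp only [Finset.mem_erase, mem_neighborFinset] at hc ha he
  obtain ⟨hac, hba⟩ := ha
  obtain ⟨hea, heb, hce⟩ := he
  have hbc := hc.ne
  have hab := hba.ne'
  have hec := hce.ne'
  obtain ⟨h, h0, hpar⟩ := hconn.exists_height (S := {b, c}) ⟨b, by simp⟩
  have h0' : ∀ v, h v = 0 ↔ v = b ∨ v = c := h0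
  let Z : Set (Sym2 V) := {s(a, b), s(b, c), s(c, e)}
  have hZ : ∀ u v, s(u, v) ∈ Z ↔ (u = a ∧ v = b ∨ u = b ∧ v = a) ∨ (u = b ∧ v = c ∨ u = c ∧ v = b)
      ∨ (u = c ∧ v = e ∨ u = e ∧ v = c) := by
    intro u v
    simp [Z]
  let A : V → Finset ℕ := fun u => if u = b then (Finset.Icc 1 (d - 1)).erase 1 else
    if u = c then (Finset.Icc 1 (d - 1)).erase 2 else Finset.Icc 1 (d - 1)
  have hAb : A b = (Finset.Icc 1 (d - 1)).erase 1 := by simp [A]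
  have hAc : A c = (Finset.Icc 1 (d - 1)).erase 2 := by simp [A, hbc.symm]
  have hA : ∀ u, A u ⊆ Finset.Icc 1 (d - 1) := by
    intro u
    simp only [A]
    split_ifs
    · exact Finset.erase_subset _ _
    · exact Finset.erase_subset _ _
    · exact subset_rfl
  have hupb : G.upNeighbors h Z b = ((G.neighborFinset b).erase c).erase a := by
    ext w
    have hw := h0' w
    have hb := (h0' b).2 (Or.inl rfl)
    have hadj : G.Adj b w → b ≠ w := Adj.ne
    simp only [mem_upNeighbors, Finset.mem_erase, mem_neighborFinset, hZ]
    grind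
  have hupc : G.upNeighbors h Z c = ((G.neighborFinset c).erase b).erase e := by
    ext w
    have hw := h0' w
    have hb := (h0' c).2 (Or.inr rfl)
    have hadj : G.Adj c w → c ≠ w := Adj.ne
    simp only [mem_upNeighbors, Finset.mem_erase, mem_neighborFinset, hZ]
    grind
  have hcardc : (G.upNeighbors h Z c).card = (A c).card := by
    rw [hupc, hAc, Finset.card_erase_of_mem, Finset.card_erase_of_mem, hN,
      Finset.card_erase_of_mem, Nat.card_Icc]
    · omega
    · simp; omega
    · simpa using hc.symm
    · simp [heb, hce]
  have hcard : ∀ u, (G.upNeighbors h Z u).card ≤ (A u).card := by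
    intro u
    by_cases hub : u = b
    · subst hub
      rw [hupb, hAb, Finset.card_erase_of_mem, Finset.card_erase_of_mem, hN,
        Finset.card_erase_of_mem, Nat.card_Icc]
      · omega
      · simp; omega
      · simpa using hc
      · simp [hac, hba]
    by_cases huc : u = c
    · subst huc
      exact hcardc.le
    have hAu : A u = Finset.Icc 1 (d - 1) := by simp [A, hub, huc]
    obtain ⟨p, hp, hlt⟩ := hpar u (by rw [Ne, h0']; tauto)
    have := card_upNeighbors_lt h Z hp.symm (Or.inl hlt.le)
    rw [hreg u] at this
    rw [hAu, Nat.card_Icc]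
    omega
  obtain ⟨l, hlt, hzero, hinj, hmem⟩ := exists_labeling (by omega) h Z A hA hcard
  refine distinguishingIndex_le_of_labeling l hlt fun φ hφ => ?_
  have hpres : ∀ u v, G.Adj u v → s(u, v) ∈ Z → s(φ u, φ v) ∈ Z := fun u v huv hm =>
    (hzero _ _ (φ.map_adj_iff.2 huv)).1 ((hφ u v huv).trans ((hzero u v huv).2 hm))
  have hφab := (hZ _ _).1 (hpres a b hba.symm ((hZ _ _).2 (by simp)))
  have hφbc := (hZ _ _).1 (hpres b c hc ((hZ _ _).2 (by simp)))
  have hφce := (hZ _ _).1 (hpres c e hce ((hZ _ _).2 (by simp)))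
  have hφac : φ a ≠ φ c := φ.injective.ne hac
  have hφeb : φ e ≠ φ b := φ.injective.ne heb
  obtain ⟨w, hw, hw1⟩ : ∃ w ∈ G.upNeighbors h Z c, l s(c, w) = 1 := by
    have himg : (G.upNeighbors h Z c).image (fun w => l s(c, w)) = A c := by
      refine Finset.eq_of_subset_of_card_le (Finset.image_subset_iff.2 (hmem c)) ?_
      rw [Finset.card_image_of_injOn (hinj c), hcardc]
    have h1 : 1 ∈ A c := by
      rw [hAc]
      simp
      omega
    rw [← himg] at h1
    simpa using h1
  have hfix : φ b = b ∧ φ c = c := by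
    have hcases : (φ b = b ∧ φ c = c) ∨ (φ b = c ∧ φ c = b) := by grind
    refine hcases.resolve_right fun ⟨_, hcb⟩ => ?_
    have hcw : G.Adj c w := (mem_upNeighbors.1 hw).1
    have hadj : G.Adj b (φ w) := by
      have := φ.map_adj_iff.2 hcw
      rwa [hcb] at this
    have hlab := hφ c w hcw
    rw [hcb, hw1] at hlab
    have hnot : s(b, φ w) ∉ Z := fun hm => by
      have := (hzero _ _ hadj).2 hm
      omega
    have hup : φ w ∈ G.upNeighbors h Z b := by
      refine mem_upNeighbors.2 ⟨hadj, ?_, hnot⟩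
      have hb := (h0' b).2 (Or.inl rfl)
      have hφw := h0' (φ w)
      have := hadj.ne
      rw [hZ] at hnot
      grind
    have := hmem b _ hup
    rw [hlab, hAb] at this
    simp at this
  refine eq_self_of_height hpar (fun u w w' huw huw' hw hw' heq => ?_) hφ ?_
  · have hu := h0' u
    by_cases hm : s(u, w) ∈ Z
    · have hm' : s(u, w') ∈ Z := by
        rw [← hzero _ _ huw', ← heq, hzero _ _ huw]
        exact hm
      have hwn := h0' w
      have hwn' := h0' w'
      rw [hZ] at hm hm'
      grind
    · have hm' : s(u, w') ∉ Z := by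
        rw [← hzero _ _ huw', ← heq, hzero _ _ huw]
        exact hm
      exact hinj u (mem_upNeighbors.2 ⟨huw, hw, hm⟩) (mem_upNeighbors.2 ⟨huw', hw', hm'⟩) heq
  · intro v hv
    rcases (h0' v).1 hv with rfl | rfl
    · exact hfix.1
    · exact hfix.2

/-- A closed sequence of distinct vertices, consecutive ones adjacent, in a connected
2-regular graph exhibits the graph as a cycle. -/
lemma Connected.nonempty_iso_cycleGraph (hconn : G.Connected) (hreg : G.IsRegularOfDegree 2)
    {n : ℕ} (p : Fin (n + 3) → V) (hp : Function.Injective p)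
    (hadj : ∀ i, G.Adj (p i) (p (i + 1))) : Nonempty (G ≃g cycleGraph (n + 3)) := by
  classical
  have hN : ∀ i, G.neighborFinset (p i) = {p (i - 1), p (i + 1)} := by
    intro i
    symm
    refine Finset.eq_of_subset_of_card_le ?_ ?_
    · intro v hv
      rw [mem_neighborFinset]
      rcases Finset.mem_insert.1 hv with rfl | hv
      · have := hadj (i - 1)
        rw [sub_add_cancel] at this
        exact this.symm
      · rw [Finset.mem_singleton.1 hv]
        exact hadj i
    · rw [card_neighborFinset_eq_degree, hreg, Finset.card_pair]
      intro heq
      have h2 : i - 1 = i + 1 := hp heq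
      have h3 : (1 : Fin (n + 3)) + 1 = 0 := by
        have : (1 : Fin (n + 3)) + 1 = (i + 1) - (i - 1) := by abel
        rw [this, h2, sub_self]
      have h4 := congrArg Fin.val h3
      simp only [Fin.val_add, Fin.val_one, Fin.val_zero] at h4
      rw [Nat.mod_eq_of_lt (by omega)] at h4
      omega
  have hiff : ∀ i v, G.Adj (p i) v ↔ v = p (i - 1) ∨ v = p (i + 1) := by
    intro i v
    rw [← mem_neighborFinset, hN]
    simp
  have hsurj : Function.Surjective p :=
    hconn.mem_of_closed (S := Set.range p) ⟨0, rfl⟩ (by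
      rintro _ ⟨i, rfl⟩ v hv
      rcases (hiff i v).1 hv with rfl | rfl
      · exact ⟨_, rfl⟩
      · exact ⟨_, rfl⟩)
  refine ⟨RelIso.symm ⟨Equiv.ofBijective p ⟨hp, hsurj⟩, ?_⟩⟩
  intro i j
  change G.Adj (p i) (p j) ↔ _
  rw [hiff, hp.eq_iff, hp.eq_iff, cycleGraph_adj]
  constructor
  · rintro (rfl | rfl)
    · left; abel
    · right; abel
  · rintro (h | h)
    · left; rw [← h]; abel
    · right; rw [← h]; abel

/-- On a cycle of length at least six with consecutive vertices `v₀, …, v₄`, the edges labeled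
zero are `v₀v₁`, `v₁v₂` and `v₃v₄`. -/
lemma Connected.distinguishingIndex_le_two (hconn : G.Connected) (hreg : G.IsRegularOfDegree 2)
    (h3 : ¬ Nonempty (G ≃g cycleGraph 3)) (h4 : ¬ Nonempty (G ≃g cycleGraph 4))
    (h5 : ¬ Nonempty (G ≃g cycleGraph 5)) : G.distinguishingIndex ≤ 2 := by
  classical
  have hnext : ∀ u v, G.Adj u v → ∃ w, w ≠ u ∧ G.Adj v w ∧ ∀ x, G.Adj v x → x = u ∨ x = w := by
    intro u v huv
    have hcard : (G.neighborFinset v).card = 2 := hreg v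
    have hu : u ∈ G.neighborFinset v := by simpa using huv.symm
    have he := Finset.card_erase_of_mem hu
    rw [hcard] at he
    obtain ⟨w, hw⟩ := Finset.card_eq_one.1 he
    have hiff : ∀ x, (x ≠ u ∧ G.Adj v x) ↔ x = w := by
      intro x
      rw [← Finset.mem_singleton, ← hw]
      simp
    refine ⟨w, ((hiff w).2 rfl).1, ((hiff w).2 rfl).2, fun x hx => ?_⟩
    have := hiff x
    tauto
  obtain ⟨v1⟩ := hconn.nonempty
  obtain ⟨v0, hv0⟩ : (G.neighborFinset v1).Nonempty :=
    Finset.card_pos.1 (by rw [card_neighborFinset_eq_degree, hreg]; omega)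
  rw [mem_neighborFinset] at hv0
  obtain ⟨v2, h20, a12, n1⟩ := hnext v0 v1 hv0.symm
  obtain ⟨v3, h31, a23, n2⟩ := hnext v1 v2 a12
  obtain ⟨v4, h42, a34, n3⟩ := hnext v2 v3 a23
  obtain ⟨y, hy1, a0y, n0⟩ := hnext v1 v0 hv0
  have a01 := hv0.symm
  have e01 := a01.ne
  have e12 := a12.ne
  have e23 := a23.ne
  have e34 := a34.ne
  have e0y := a0y.ne
  have h30 : v3 ≠ v0 := by
    rintro rfl
    refine h3 (hconn.nonempty_iso_cycleGraph (n := 0) hreg ![v3, v1, v2] ?_ ?_)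
    · intro i j hij
      fin_cases i <;> fin_cases j <;> simp_all
    · intro i
      fin_cases i
      · exact a01
      · exact a12
      · exact a23
  have h41 : v4 ≠ v1 := by
    rintro rfl
    have := n1 v3 a34.symm
    grind
  have h40 : v4 ≠ v0 := by
    rintro rfl
    refine h4 (hconn.nonempty_iso_cycleGraph (n := 1) hreg ![v4, v1, v2, v3] ?_ ?_)
    · intro i j hij
      fin_cases i <;> fin_cases j <;> simp_all
    · intro i
      fin_cases i
      · exact a01
      · exact a12
      · exact a23
      · exact a34
  have hy4 : y ≠ v4 := by
    rintro rfl
    refine h5 (hconn.nonempty_iso_cycleGraph (n := 2) hreg ![v0, v1, v2, v3, y] ?_ ?_)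
    · intro i j hij
      fin_cases i <;> fin_cases j <;> simp_all
    · intro i
      fin_cases i
      · exact a01
      · exact a12
      · exact a23
      · exact a34
      · exact a0y.symm
  have hy2 : y ≠ v2 := by
    rintro rfl
    have := n2 v0 a0y.symm
    grind
  have hy3 : y ≠ v3 := by
    rintro rfl
    have := n3 v0 a0y.symm
    grind
  let Z : Set (Sym2 V) := {s(v0, v1), s(v1, v2), s(v3, v4)}
  have hZ : ∀ u v, s(u, v) ∈ Z ↔ (u = v0 ∧ v = v1 ∨ u = v1 ∧ v = v0) ∨
      (u = v1 ∧ v = v2 ∨ u = v2 ∧ v = v1) ∨ (u = v3 ∧ v = v4 ∨ u = v4 ∧ v = v3) := by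
    intro u v
    simp [Z]
  refine distinguishingIndex_le_of_labeling (fun e => if e ∈ Z then 0 else 1)
    (fun e _ => by split_ifs <;> omega) fun φ hφ => ?_
  have hpres : ∀ u v, G.Adj u v → s(u, v) ∈ Z → s(φ u, φ v) ∈ Z := by
    intro u v huv hm
    have := hφ u v huv
    simp only [if_pos hm] at this
    by_contra hn
    simp [hn] at this
  obtain ⟨h, h0, hpar⟩ := hconn.exists_height (S := {v0, v1, v2}) ⟨v0, by simp⟩
  have h0' : ∀ v, h v = 0 ↔ v = v0 ∨ v = v1 ∨ v = v2 := h0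
  have p01 := (hZ _ _).1 (hpres v0 v1 a01 ((hZ _ _).2 (by simp)))
  have p12 := (hZ _ _).1 (hpres v1 v2 a12 ((hZ _ _).2 (by simp)))
  have p34 := (hZ _ _).1 (hpres v3 v4 a34 ((hZ _ _).2 (by simp)))
  have hφ20 : φ v2 ≠ φ v0 := φ.injective.ne h20
  have hφ31 : φ v3 ≠ φ v1 := φ.injective.ne h31
  have hφ23 : G.Adj (φ v2) (φ v3) := φ.map_adj_iff.2 a23
  have hfix1 : φ v1 = v1 := by grind
  have hfix2 : φ v2 = v2 := by
    by_contra hne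
    have h2 : φ v2 = v0 := by grind
    rw [h2] at hφ23
    have := n0 _ hφ23
    grind
  have hfix0 : φ v0 = v0 := by grind
  refine eq_self_of_height (l := fun e => if e ∈ Z then 0 else 1) hpar
    (fun u w w' huw huw' hw hw' _ => ?_) hφ ?_
  · obtain ⟨q, hq, hle⟩ : ∃ q, G.Adj q u ∧ h q ≤ h u := by
      by_cases hu : h u = 0
      · rcases (h0' u).1 hu with rfl | rfl | rfl
        · exact ⟨v1, hv0, by rw [(h0' v1).2 (by simp)]; omega⟩
        · exact ⟨v0, a01, by rw [(h0' v0).2 (by simp)]; omega⟩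
        · exact ⟨v1, a12, by rw [(h0' v1).2 (by simp)]; omega⟩
      · obtain ⟨q, hq, hlt⟩ := hpar u hu
        exact ⟨q, hq, hlt.le⟩
    obtain ⟨x, -, -, hx⟩ := hnext q u hq
    have hxw := hx w huw
    have hxw' := hx w' huw'
    grind
  · intro v hv
    rcases (h0' v).1 hv with rfl | rfl | rfl
    · exact hfix0
    · exact hfix1
    · exact hfix2

end

end SimpleGraph

theorem distinguishingIndex_le_maxDegree
    {V : Type*} [Fintype V] (G : SimpleGraph V) [DecidableRel G.Adj]
    (hconn : G.Connected) (hn : 3 ≤ Fintype.card V)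
    (h3 : ¬ Nonempty (G ≃g SimpleGraph.cycleGraph 3))
    (h4 : ¬ Nonempty (G ≃g SimpleGraph.cycleGraph 4))
    (h5 : ¬ Nonempty (G ≃g SimpleGraph.cycleGraph 5)) :
    G.distinguishingIndex ≤ G.maxDegree := by
  by_cases hreg : ∀ b c, G.Adj b c → G.degree b = G.degree c
  · obtain ⟨r, hr⟩ := @SimpleGraph.exists_maximal_degree_vertex V G _ _ hconn.nonempty
    have hall : G.IsRegularOfDegree G.maxDegree :=
      hconn.mem_of_closed (S := {v | G.degree v = G.maxDegree}) hr.symm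
        fun u hu v huv => (hreg u v huv).symm.trans hu
    have h2 := hconn.two_le_maxDegree hn
    rcases h2.eq_or_lt with h2 | h2
    · rw [← h2] at hall ⊢
      exact hconn.distinguishingIndex_le_two hall h3 h4 h5
    · exact hconn.distinguishingIndex_le_of_regular h2 hall
  · push Not at hreg
    obtain ⟨b, c, hbc, hne⟩ := hreg
    exact hconn.distinguishingIndex_le_of_degree_ne hbc hne
end

section
/- Let G be a finite connected simple graph with minimum degree δ ≥ 2 and maximum degree Δ. Then D'(G) ≤ ⌈√Δ⌉ + 1, i.e. G admits a distinguishing edge labeling with ⌈√Δ⌉ + 1 labels. -/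
namespace SimpleGraph

variable {V : Type*} {G : SimpleGraph V}

theorem distinguishingIndex_le_card {Λ : Type*} [Fintype Λ] (F : V → V → Λ)
    (hsymm : ∀ u v, F u v = F v u)
    (h : ∀ φ : G ≃g G, (∀ u v, G.Adj u v → F (φ u) (φ v) = F u v) → ∀ v, φ v = v) :
    G.distinguishingIndex ≤ Fintype.card Λ := by
  refine Nat.sInf_le ⟨fun e => Fintype.equivFin Λ (Sym2.lift ⟨F, hsymm⟩ e.1), fun φ hφ => ?_⟩
  refine h φ fun u v huv => ?_
  exact (Fintype.equivFin Λ).injective (hφ ⟨s(u, v), huv⟩)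

/-- Edge weights with prescribed vertex sums on a set `S` of vertices exist as soon as every
nonempty subset of `S` is left by some edge. -/
theorem exists_edge_weight {A : Type*} [AddCommGroup A] [Fintype V] [DecidableEq V]
    (H : SimpleGraph V) [DecidableRel H.Adj] (t : V → A) (S : Finset V)
    (hS : ∀ T ⊆ S, T.Nonempty → ∃ u ∈ T, ∃ w, w ∉ T ∧ H.Adj u w) :
    ∃ g : Sym2 V → A, ∀ u ∈ S, ∑ w ∈ H.neighborFinset u, g s(u, w) = t u := by
  induction S using Finset.strongInduction with
  | H S ih =>
  rcases S.eq_empty_or_nonempty with rfl | hne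
  · exact ⟨fun _ => 0, by simp⟩
  obtain ⟨u, hu, w, hw, huw⟩ := hS S subset_rfl hne
  obtain ⟨g, hg⟩ := ih (S.erase u) (Finset.erase_ssubset hu)
    fun T hT => hS T (hT.trans (Finset.erase_subset u S))
  refine ⟨Function.update g s(u, w)
    (g s(u, w) + (t u - ∑ x ∈ H.neighborFinset u, g s(u, x))), fun v hv => ?_⟩
  by_cases hvu : v = u
  · subst hvu
    have hmem : w ∈ H.neighborFinset v := by simpa using huw
    have hrest : ∀ c, ∑ x ∈ (H.neighborFinset v).erase w, Function.update g s(v, w) c s(v, x) =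
        ∑ x ∈ (H.neighborFinset v).erase w, g s(v, x) := by
      intro c
      refine Finset.sum_congr rfl fun x hx => Function.update_of_ne ?_ _ _
      have := Finset.ne_of_mem_erase hx
      grind
    rw [← Finset.add_sum_erase _ (fun x => Function.update g _ _ s(v, x)) hmem, hrest,
      Function.update_self, ← Finset.add_sum_erase _ (fun x => g s(v, x)) hmem]
    abel
  · rw [← hg v (Finset.mem_erase.2 ⟨hvu, hv⟩)]
    refine Finset.sum_congr rfl fun x _ => Function.update_of_ne ?_ _ _
    have : v ≠ w := fun h => hw (h ▸ hv)
    grind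

/-- Let every vertex of `L` have a designated neighbour outside `L` and at least one further
neighbour. Then some subset `R` of `L` can be discarded such that every nonempty subset of `L \ R`
is left by an undesignated edge, while every vertex of `R` is the only neighbour in `R` of some
vertex of `L \ R`. -/
theorem exists_discarded_set [DecidableEq V] (L : Finset V) (p : V → V)
    (hp : ∀ u ∈ L, p u ∉ L) (hdeg : ∀ u ∈ L, ∃ w, G.Adj u w ∧ w ≠ p u) :
    ∃ R ⊆ L, (∀ T ⊆ L \ R, T.Nonempty → ∃ u ∈ T, ∃ w, w ∉ T ∧ G.Adj u w ∧ w ≠ p u) ∧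
      ∀ r ∈ R, ∃ x ∈ L, x ∉ R ∧ G.Adj r x ∧ ∀ w, G.Adj x w → w ∈ R → w = r := by
  let P : Finset V → Prop := fun R => R ⊆ L ∧
    ∀ T ⊆ L \ R, T.Nonempty → ∃ u ∈ T, ∃ w, w ∉ T ∧ G.Adj u w ∧ w ≠ p u
  have hex : ∃ R, P R := ⟨L, subset_rfl, by
    intro T hT hne
    rw [Finset.sdiff_self, Finset.subset_empty] at hT
    simp [hT] at hne⟩
  obtain ⟨R, hR, hmin⟩ := WellFounded.has_min (measure (Finset.card (α := V))).wf {R | P R} hex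
  refine ⟨R, hR.1, hR.2, fun r hr => ?_⟩
  have hnot : ¬ P (R.erase r) := fun h => hmin _ h (Finset.card_erase_lt_of_mem hr)
  have hsub : R.erase r ⊆ L := (Finset.erase_subset r R).trans hR.1
  simp only [P, hsub, true_and] at hnot
  push Not at hnot
  obtain ⟨T, hT, hne, hclosed⟩ := hnot
  have hTmem : ∀ {u}, u ∈ T → u ∈ L ∧ (u ∈ R → u = r) := by
    intro u hu
    have := hT hu
    simp only [Finset.mem_sdiff, Finset.mem_erase] at this
    grind
  have hrT : r ∈ T := by
    by_contra hrT
    obtain ⟨u, hu, w, hw, huw, hwp⟩ := hR.2 T (fun u hu => by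
      have := hTmem hu
      grind) hne
    exact hwp (hclosed u hu w hw huw)
  obtain ⟨x, hrx, hxp⟩ := hdeg r (hR.1 hr)
  have hxT : x ∈ T := by
    by_contra hxT
    exact hxp (hclosed r hrT x hxT hrx)
  refine ⟨x, (hTmem hxT).1, fun hxR => hrx.ne ((hTmem hxT).2 hxR).symm, hrx, fun w hxw hwR => ?_⟩
  by_cases hwT : w ∈ T
  · exact (hTmem hwT).2 hwR
  · exact absurd (hR.1 hwR) (hclosed x hxT w hwT hxw ▸ hp x (hTmem hxT).1)

/-- A parent function of a search from a root `b`. -/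
theorem exists_parent [Fintype V] (hconn : G.Connected) (b : V) :
    ∃ (ord : V → ℕ) (p : V → V), Function.Injective ord ∧ ∀ u, u ≠ b →
      G.Adj u (p u) ∧ ord (p u) < ord u ∧ ∀ w, G.Adj u w → ord (p u) ≤ ord w := by
  classical
  let e := Fintype.equivFin V
  let n := Fintype.card V
  let ord : V → ℕ := fun v => G.dist b v * n + e v
  have hlt : ∀ {u w}, G.dist b u < G.dist b w → ord u < ord w := by
    intro u w h
    have h1 : (e u : ℕ) < n := (e u).2
    have h2 : (G.dist b u + 1) * n ≤ G.dist b w * n := Nat.mul_le_mul_right n h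
    simp only [ord]
    nlinarith
  have hinj : Function.Injective ord := by
    intro u w h
    rcases lt_trichotomy (G.dist b u) (G.dist b w) with h' | h' | h'
    · exact absurd h (hlt h').ne
    · simp only [ord, h'] at h
      exact e.injective (Fin.ext (by omega))
    · exact absurd h (hlt h').ne'
  have hnear : ∀ u, u ≠ b → ∃ w, G.Adj u w ∧ G.dist b w < G.dist b u := by
    intro u hu
    obtain ⟨q, hq⟩ := hconn.exists_walk_length_eq_dist u b
    cases q with
    | nil => exact absurd rfl hu
    | cons hadj q =>
      refine ⟨_, hadj, ?_⟩
      rw [G.dist_comm (u := b), G.dist_comm (u := b), ← hq, Walk.length_cons]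
      exact Nat.lt_succ_of_le (dist_le q)
  have hmin : ∀ u, ∃ w, u ≠ b → G.Adj u w ∧ ord w < ord u ∧ ∀ x, G.Adj u x → ord w ≤ ord x := by
    intro u
    by_cases hu : u = b
    · exact ⟨u, fun h => absurd hu h⟩
    obtain ⟨w, hw, hd⟩ := hnear u hu
    obtain ⟨m, hm, hmin⟩ := (G.neighborFinset u).exists_min_image ord ⟨w, by simpa using hw⟩
    simp only [mem_neighborFinset] at hm hmin
    exact ⟨m, fun _ => ⟨hm, (hmin w hw).trans_lt (hlt hd), hmin⟩⟩
  choose p hp using hmin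
  exact ⟨ord, p, hinj, hp⟩

end SimpleGraph

/-- Injective labels with values in pairs, the second components being prescribed and the sum of
the first components being arbitrary. -/
theorem exists_second_label {V : Type*} [DecidableEq V] {k : ℕ} (hk : 2 ≤ k) (U : Finset V)
    (hne : U.Nonempty) (hcard : U.card < k ^ 2) :
    ∃ t : V → ZMod k, ∀ σ, ∃ a : V → ZMod k, ∑ u ∈ U, a u = σ ∧
      ∀ u ∈ U, ∀ u' ∈ U, a u = a u' → t u = t u' → u = u' := by
  have : NeZero k := ⟨by omega⟩
  have : Fact (1 < k) := ⟨by omega⟩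
  obtain ⟨Q, hQ1, hQ2, hQ⟩ := Finset.exists_subsuperset_card_eq
    (s := {((1 : ZMod k), (0 : ZMod k))}) (t := Finset.univ.erase (0, 0)) (n := U.card)
    (by simp) (by simpa using hne.card_pos) (by
      rw [Finset.card_erase_of_mem (Finset.mem_univ _), Finset.card_univ, Fintype.card_prod,
        ZMod.card, ← pow_two]
      omega)
  let e := Finset.equivOfCardEq hQ.symm
  let c : V → ZMod k × ZMod k := fun u => if h : u ∈ U then (e ⟨u, h⟩).1 else 0
  have hc : ∀ {u} (h : u ∈ U), c u = (e ⟨u, h⟩).1 := fun h => by simp [c, h]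
  have hcQ : ∀ {u}, u ∈ U → c u ∈ Q := fun h => by rw [hc h]; exact (e ⟨_, h⟩).2
  have hcinj : ∀ u ∈ U, ∀ u' ∈ U, c u = c u' → u = u' := by
    intro u hu u' hu' h
    rw [hc hu, hc hu'] at h
    simpa using e.injective (Subtype.ext h)
  let W := {u ∈ U | (c u).2 = 0}
  have hWU : ∀ {u}, u ∈ W ↔ u ∈ U ∧ (c u).2 = 0 := by simp [W]
  have hWne : W.Nonempty := by
    have h10 : ((1 : ZMod k), (0 : ZMod k)) ∈ Q := hQ1 (by simp)
    refine ⟨(e.symm ⟨_, h10⟩).1, hWU.2 ⟨(e.symm ⟨_, h10⟩).2, ?_⟩⟩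
    rw [hc (e.symm ⟨_, h10⟩).2]
    simp
  have hWcard : W.card < k := by
    have hle : W.card ≤ ((Finset.univ : Finset (ZMod k)).erase 0).card := by
      refine Finset.card_le_card_of_injOn (fun u => (c u).1) (fun u hu => ?_) fun u hu u' hu' h => ?_
      · have hu := hWU.1 hu
        have := hQ2 (hcQ hu.1)
        simp only [Finset.mem_erase, Finset.mem_univ, and_true, ne_eq, Finset.coe_erase,
          Finset.coe_univ, Set.mem_sdiff, Set.mem_univ, Set.mem_singleton_iff, true_and] at this ⊢
        exact fun h => this (Prod.ext h hu.2)
      · have hu := hWU.1 hu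
        have hu' := hWU.1 hu'
        exact hcinj u hu.1 u' hu'.1 (Prod.ext h (hu.2.trans hu'.2.symm))
    rw [Finset.card_erase_of_mem (Finset.mem_univ _), Finset.card_univ, ZMod.card] at hle
    omega
  refine ⟨fun u => (c u).2, fun σ => ?_⟩
  have hstep : ∀ n : ℕ, ∃ a : V → ZMod k, ∑ u ∈ U, a u = ∑ u ∈ U, (c u).1 + n ∧
      ∀ u ∈ U, ∀ u' ∈ U, a u = a u' → (c u).2 = (c u').2 → u = u' := by
    intro n
    induction n with
    | zero => exact ⟨fun u => (c u).1, by simp, fun u hu u' hu' h h' =>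
        hcinj u hu u' hu' (Prod.ext h h')⟩
    | succ n ih =>
      obtain ⟨a, hsum, hinj⟩ := ih
      obtain ⟨u, huW, hu⟩ : ∃ u ∈ W, a u + 1 ∉ W.image a := by
        by_contra! hcl
        obtain ⟨w, hw⟩ := hWne
        have hall : ∀ m : ℕ, a w + m ∈ W.image a := by
          intro m
          induction m with
          | zero => simpa using ⟨w, hw, rfl⟩
          | succ m ihm =>
            obtain ⟨x, hx, hxe⟩ := Finset.mem_image.1 ihm
            have := hcl x hx
            rwa [hxe, add_assoc, ← Nat.cast_succ] at this
        have huniv : W.image a = Finset.univ := by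
          refine Finset.eq_univ_of_forall fun y => ?_
          have := hall (y - a w).val
          rwa [ZMod.natCast_zmod_val, add_sub_cancel] at this
        have := Finset.card_image_le (s := W) (f := a)
        rw [huniv, Finset.card_univ, ZMod.card] at this
        omega
      have huU := (hWU.1 huW).1
      refine ⟨Function.update a u (a u + 1), ?_, ?_⟩
      · rw [Finset.sum_update_of_mem huU, ← Finset.erase_eq, add_right_comm,
          Finset.add_sum_erase _ _ huU, hsum]
        push_cast
        ring
      · have hfresh : ∀ x ∈ U, (c x).2 = (c u).2 → a x ≠ a u + 1 := by
          intro x hx hxu h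
          exact hu (Finset.mem_image.2 ⟨x, hWU.2 ⟨hx, hxu.trans (hWU.1 huW).2⟩, h⟩)
        intro x hx x' hx' h h'
        by_cases hxu : x = u <;> by_cases hxu' : x' = u
        · rw [hxu, hxu']
        · subst hxu
          rw [Function.update_self, Function.update_of_ne hxu'] at h
          exact absurd h.symm (hfresh x' hx' h'.symm)
        · subst hxu'
          rw [Function.update_self, Function.update_of_ne hxu] at h
          exact absurd h (hfresh x hx h')
        · rw [Function.update_of_ne hxu, Function.update_of_ne hxu'] at h
          exact hinj x hx x' hx' h h'
  obtain ⟨a, ha, hinj⟩ := hstep (σ - ∑ u ∈ U, (c u).1).val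
  exact ⟨a, by rw [ha, ZMod.natCast_zmod_val, add_sub_cancel], hinj⟩

/-- The variant of `exists_second_label` in which the elements of `R` only have to be labelled
differently from those outside `R`, and an additional label of weight zero is available for them. -/
theorem exists_second_label_sdiff {V : Type*} [DecidableEq V] {k : ℕ} (hk : 2 ≤ k)
    (N R : Finset V) (hcard : N.card < k ^ 2) :
    ∃ t : V → ZMod k, ∀ σ, ∃ a : V → Option (ZMod k),
      (N.Nonempty → ∑ u ∈ N, (a u).getD 0 = σ) ∧ (∀ u ∈ N, u ∉ R → a u ≠ none) ∧
      (∀ u ∈ N, u ∉ R → ∀ u' ∈ N, u' ∉ R → a u = a u' → t u = t u' → u = u') ∧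
      ∀ u ∈ N, u ∉ R → ∀ r ∈ N, r ∈ R → a u ≠ a r := by
  rcases (N \ R).eq_empty_or_nonempty with hU | hU
  · have hNR : ∀ u ∈ N, u ∈ R := fun u hu => by
      by_contra h
      exact Finset.notMem_empty u (hU ▸ Finset.mem_sdiff.2 ⟨hu, h⟩)
    refine ⟨fun _ => 0, fun σ => ?_⟩
    rcases N.eq_empty_or_nonempty with rfl | ⟨v, hv⟩
    · exact ⟨fun _ => none, by simp⟩
    · refine ⟨fun u => some (if u = v then σ else 0), ?_, ?_, ?_, ?_⟩
      · simp [hv]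
      all_goals exact fun u hu hu' => absurd (hNR u hu) hu'
  · obtain ⟨t, ht⟩ := exists_second_label hk (N \ R) hU
      ((Finset.card_le_card Finset.sdiff_subset).trans_lt hcard)
    refine ⟨t, fun σ => ?_⟩
    obtain ⟨a, hsum, hinj⟩ := ht σ
    refine ⟨fun u => if u ∈ R then none else some (a u), fun _ => ?_, ?_, ?_, ?_⟩
    · rw [← hsum, Finset.sdiff_eq_filter, Finset.sum_filter]
      refine Finset.sum_congr rfl fun u _ => ?_
      by_cases h : u ∈ R <;> simp [h]
    · intro u _ hu
      simp [hu]
    · intro u hu huR u' hu' huR' h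
      simp only [huR, huR', if_false, Option.some.injEq] at h
      exact hinj u (by simp [hu, huR]) u' (by simp [hu', huR']) h
    · intro u _ hu r _ hr
      simp [hu, hr]

namespace SimpleGraph

variable {V : Type*} {G : SimpleGraph V}

/-- The vertices `b 0, …, b l` form a path of length `l`. -/
def IsPathSeq (G : SimpleGraph V) (l : ℕ) (b : ℕ → V) : Prop :=
  Set.InjOn b (Set.Iic l) ∧ ∀ i < l, G.Adj (b i) (b (i + 1))

/-- The vertices `b 0, …, b l` form a path of maximum length. -/
def IsLongestPathSeq (G : SimpleGraph V) (l : ℕ) (b : ℕ → V) : Prop :=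
  G.IsPathSeq l b ∧ ∀ m c, G.IsPathSeq m c → m ≤ l

theorem exists_isLongestPathSeq [Fintype V] [Nonempty V] (G : SimpleGraph V) :
    ∃ l b, G.IsLongestPathSeq l b := by
  classical
  have hbound : ∀ m, (∃ c, G.IsPathSeq m c) → m ≤ Fintype.card V := by
    rintro m ⟨c, hc, -⟩
    have := Finset.card_le_card_of_injOn (s := Finset.Iic m) (t := Finset.univ) c (by simp)
      (by simpa using hc)
    simp only [Nat.card_Iic, Finset.card_univ] at this
    omega
  have h0 : ∃ c, G.IsPathSeq 0 c :=
    ⟨fun _ => Classical.arbitrary V, fun i hi j hj _ => by simp_all, by simp⟩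
  obtain ⟨b, hb⟩ := Nat.findGreatest_spec (P := fun m => ∃ c, G.IsPathSeq m c)
    (Nat.zero_le (Fintype.card V)) h0
  exact ⟨_, b, hb, fun m c hc => Nat.le_findGreatest (hbound m ⟨c, hc⟩) ⟨c, hc⟩⟩

namespace IsPathSeq

variable {l : ℕ} {b : ℕ → V}

theorem eq_of_eq (hb : G.IsPathSeq l b) {i j : ℕ} (hi : i ≤ l) (hj : j ≤ l) (h : b i = b j) :
    i = j :=
  hb.1 hi hj h

theorem reverse (hb : G.IsPathSeq l b) : G.IsPathSeq l fun i => b (l - i) := by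
  refine ⟨fun i hi j hj h => ?_, fun i hi => ?_⟩
  · have := hb.eq_of_eq (Nat.sub_le l i) (Nat.sub_le l j) h
    simp only [Set.mem_Iic] at hi hj
    omega
  · have := hb.2 (l - (i + 1)) (by omega)
    rw [show l - (i + 1) + 1 = l - i by omega] at this
    exact this.symm

theorem map (hb : G.IsPathSeq l b) (φ : G ≃g G) : G.IsPathSeq l fun i => φ (b i) :=
  ⟨fun _ hi _ hj h => hb.1 hi hj (φ.injective h), fun i hi => φ.map_rel_iff.2 (hb.2 i hi)⟩

theorem cons (hb : G.IsPathSeq l b) {w : V} (hw : G.Adj (b 0) w) (hnew : ∀ i ≤ l, b i ≠ w) :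
    ∃ c, G.IsPathSeq (l + 1) c := by
  refine ⟨fun i => Nat.casesOn i w b, ?_, ?_⟩
  · rintro (_ | i) hi (_ | j) hj h
    · rfl
    · exact absurd h.symm (hnew j (by simpa using hj))
    · exact absurd h (hnew i (by simpa using hi))
    · exact congrArg (· + 1) (hb.eq_of_eq (by simpa using hi) (by simpa using hj) h)
  · rintro (_ | i) hi
    · exact hw.symm
    · exact hb.2 i (by omega)

theorem rotate (hb : G.IsPathSeq l b) (h : G.Adj (b l) (b 0)) (j : ℕ) :
    G.IsPathSeq l fun i => b ((i + j) % (l + 1)) := by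
  have hlt : ∀ i, i % (l + 1) < l + 1 := fun i => Nat.mod_lt _ l.succ_pos
  refine ⟨fun i hi i' hi' h => ?_, fun i hi => ?_⟩
  · have h := hb.eq_of_eq (Nat.le_of_lt_succ (hlt _)) (Nat.le_of_lt_succ (hlt _)) h
    have h : i ≡ i' [MOD l + 1] := Nat.ModEq.add_right_cancel' j h
    simp only [Set.mem_Iic] at hi hi'
    exact Nat.ModEq.eq_of_lt_of_lt h (by omega) (by omega)
  · have hmod : (i + 1 + j) % (l + 1) = ((i + j) % (l + 1) + 1) % (l + 1) := by
      rw [Nat.mod_add_mod, add_right_comm]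
    simp only [hmod]
    have := hlt (i + j)
    rcases Nat.lt_or_ge ((i + j) % (l + 1)) l with hlt' | hge
    · rw [Nat.mod_eq_of_lt (by omega : (i + j) % (l + 1) + 1 < l + 1)]
      exact hb.2 _ hlt'
    · rw [show (i + j) % (l + 1) = l by omega, Nat.mod_self]
      exact h

end IsPathSeq

namespace IsLongestPathSeq

variable {l : ℕ} {b : ℕ → V}

theorem reverse (hb : G.IsLongestPathSeq l b) : G.IsLongestPathSeq l fun i => b (l - i) :=
  ⟨hb.1.reverse, hb.2⟩

theorem map (hb : G.IsLongestPathSeq l b) (φ : G ≃g G) : G.IsLongestPathSeq l fun i => φ (b i) :=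
  ⟨hb.1.map φ, hb.2⟩

theorem exists_eq_of_adj_zero (hb : G.IsLongestPathSeq l b) {w : V} (hw : G.Adj (b 0) w) :
    ∃ i ≤ l, b i = w := by
  by_contra! hnew
  obtain ⟨c, hc⟩ := hb.1.cons hw hnew
  have := hb.2 _ c hc
  omega

theorem exists_eq_of_adj_last (hb : G.IsLongestPathSeq l b) {w : V} (hw : G.Adj (b l) w) :
    ∃ i ≤ l, b i = w := by
  obtain ⟨i, -, hi⟩ := hb.reverse.exists_eq_of_adj_zero (w := w) (by simpa using hw)
  exact ⟨l - i, Nat.sub_le l i, hi⟩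

/-- If the ends of a longest path are adjacent, the path is Hamiltonian. -/
theorem exists_eq_of_adj_ends (hb : G.IsLongestPathSeq l b) (hconn : G.Connected)
    (h : G.Adj (b l) (b 0)) (v : V) : ∃ i ≤ l, b i = v := by
  by_contra hv
  obtain ⟨q⟩ := hconn (b 0) v
  obtain ⟨d, -, ⟨j, hj, hd⟩, hd'⟩ :=
    q.exists_boundary_dart {v | ∃ i ≤ l, b i = v} ⟨0, Nat.zero_le l, rfl⟩ hv
  have hrot : G.IsLongestPathSeq l fun i => b ((i + j) % (l + 1)) := ⟨hb.1.rotate h j, hb.2⟩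
  obtain ⟨i, -, hi⟩ := hrot.exists_eq_of_adj_zero (w := d.snd) (by
    simp [Nat.mod_eq_of_lt (Nat.lt_succ_of_le hj), hd])
  exact hd' ⟨_, Nat.le_of_lt_succ (Nat.mod_lt _ l.succ_pos), hi⟩

theorem two_le [Fintype V] [DecidableRel G.Adj] (hb : G.IsLongestPathSeq l b)
    (hδ : 2 ≤ G.minDegree) : 2 ≤ l := by
  classical
  have hsub : insert (b 0) (G.neighborFinset (b 0)) ⊆ (Finset.Iic l).image b := by
    intro w hw
    rcases Finset.mem_insert.1 hw with rfl | hw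
    · exact Finset.mem_image.2 ⟨0, by simp, rfl⟩
    · obtain ⟨i, hi, rfl⟩ := hb.exists_eq_of_adj_zero (by simpa using hw)
      exact Finset.mem_image.2 ⟨i, by simpa using hi, rfl⟩
  have h1 := (Finset.card_le_card hsub).trans Finset.card_image_le
  rw [Finset.card_insert_of_notMem (by simp), G.card_neighborFinset_eq_degree, Nat.card_Iic] at h1
  have := hδ.trans (G.minDegree_le_degree (b 0))
  omega

/-- If a longest path is not Hamiltonian, its first vertex has a neighbour other than the second
vertex and the last one. -/
theorem exists_chord [Fintype V] [DecidableRel G.Adj] (hb : G.IsLongestPathSeq l b)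
    (hconn : G.Connected) (hδ : 2 ≤ G.minDegree) {v : V} (hv : ∀ i ≤ l, b i ≠ v) :
    ∃ j ≤ l, G.Adj (b 0) (b j) ∧ j ≠ 1 ∧ j ≠ l := by
  classical
  have hcard : 1 < (G.neighborFinset (b 0)).card := by
    rw [G.card_neighborFinset_eq_degree]
    exact hδ.trans (G.minDegree_le_degree (b 0))
  obtain ⟨w, hw, hne⟩ := Finset.exists_mem_ne hcard (b 1)
  rw [mem_neighborFinset] at hw
  obtain ⟨j, hj, rfl⟩ := hb.exists_eq_of_adj_zero hw
  refine ⟨j, hj, hw, fun h => hne (h ▸ rfl), fun h => ?_⟩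
  subst h
  obtain ⟨i, hi, h⟩ := hb.exists_eq_of_adj_ends hconn hw.symm v
  exact hv i hi h

end IsLongestPathSeq

end SimpleGraph

/-- An injective map of `{0, …, l}` to itself with consecutive values at consecutive numbers is
the identity or the reversal. -/
theorem eq_id_or_eq_reverse_of_consecutive {l : ℕ} {π : ℕ → ℕ} (hle : ∀ i ≤ l, π i ≤ l)
    (hinj : Set.InjOn π (Set.Iic l)) (hstep : ∀ i < l, π (i + 1) = π i + 1 ∨ π i = π (i + 1) + 1) :
    (∀ i ≤ l, π i = i) ∨ ∀ i ≤ l, π i = l - i := by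
  rcases Nat.eq_zero_or_pos l with rfl | hl
  · left
    intro i hi
    have := hle i hi
    omega
  rcases hstep 0 hl with h0 | h0
  · have hup : ∀ i < l, π (i + 1) = π i + 1 := by
      intro i
      induction i with
      | zero => exact fun _ => h0
      | succ i ih =>
        intro hi
        have := ih (by omega)
        rcases hstep (i + 1) hi with h | h
        · exact h
        · have := hinj (show i ∈ Set.Iic l by simp; omega)
            (show i + 1 + 1 ∈ Set.Iic l by simp; omega) (by omega)
          omega
    have hval : ∀ i ≤ l, π i = π 0 + i := by
      intro i
      induction i with
      | zero => simp
      | succ i ih =>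
        intro hi
        have := ih (by omega)
        have := hup i hi
        omega
    left
    intro i hi
    have := hval i hi
    have := hval l le_rfl
    have := hle l le_rfl
    omega
  · have hdown : ∀ i < l, π i = π (i + 1) + 1 := by
      intro i
      induction i with
      | zero => exact fun _ => h0
      | succ i ih =>
        intro hi
        have := ih (by omega)
        rcases hstep (i + 1) hi with h | h
        · have := hinj (show i ∈ Set.Iic l by simp; omega)
            (show i + 1 + 1 ∈ Set.Iic l by simp; omega) (by omega)
          omega
        · exact h
    have hval : ∀ i ≤ l, π i + i = π 0 := by
      intro i
      induction i with
      | zero => simp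
      | succ i ih =>
        intro hi
        have := ih (by omega)
        have := hdown i hi
        omega
    right
    intro i hi
    have := hval i hi
    have := hval l le_rfl
    have := hle 0 (by omega)
    omega

namespace SimpleGraph

variable {V : Type*} {G : SimpleGraph V}

/-- A graph with a Hamiltonian path of length at least two has a distinguishing labeling with any
three labels. -/
theorem distinguishingIndex_le_card_of_hamiltonian {Λ : Type*} [Fintype Λ] {l : ℕ} {b : ℕ → V}
    (hb : G.IsPathSeq l b) (hl : 2 ≤ l) (hcover : ∀ v, ∃ i ≤ l, b i = v) {x y z : Λ}
    (hxy : x ≠ y) (hxz : x ≠ z) (hyz : y ≠ z) : G.distinguishingIndex ≤ Fintype.card Λ := by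
  classical
  let F : V → V → Λ := fun u v => if s(u, v) = s(b 0, b 1) then x else
    if ∃ i < l, s(u, v) = s(b i, b (i + 1)) then y else z
  have hF0 : F (b 0) (b 1) = x := by simp [F]
  have hFx : ∀ {u v}, F u v = x → s(u, v) = s(b 0, b 1) := by
    intro u v h
    by_contra hne
    simp only [F, hne, if_false] at h
    split_ifs at h
    exacts [hxy h.symm, hxz h.symm]
  have hFy : ∀ {u v}, F u v = y → ∃ i < l, 0 < i ∧ s(u, v) = s(b i, b (i + 1)) := by
    intro u v h
    simp only [F] at h
    split_ifs at h with h1 h2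
    · exact absurd h hxy
    · obtain ⟨i, hi, h⟩ := h2
      refine ⟨i, hi, Nat.pos_of_ne_zero fun h0 => h1 ?_, h⟩
      rwa [h0] at h
    · exact absurd h.symm hyz
  have hFstep : ∀ i < l, 0 < i → F (b i) (b (i + 1)) = y := by
    intro i hi hi0
    have hne : s(b i, b (i + 1)) ≠ s(b 0, b 1) := by
      rw [Ne, Sym2.eq_iff]
      rintro (⟨h, -⟩ | ⟨-, h⟩)
      · have := hb.eq_of_eq (by omega) (by omega) h
        omega
      · have := hb.eq_of_eq (by omega) (by omega) h
        omega
    simp only [F, hne, if_false]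
    exact if_pos ⟨i, hi, rfl⟩
  refine distinguishingIndex_le_card F (fun u v => by simp only [F, Sym2.eq_swap]) fun φ hφ => ?_
  have h01 : φ (b 0) = b 0 ∧ φ (b 1) = b 1 := by
    have h := hFx ((hφ _ _ (hb.2 0 (by omega))).trans hF0)
    rcases Sym2.eq_iff.1 h with h | ⟨-, h⟩
    · exact h
    · have h2 := (hφ _ _ (hb.2 1 (by omega))).trans (hFstep 1 (by omega) one_pos)
      rw [h] at h2
      obtain ⟨i, hi, hi0, h2⟩ := hFy h2
      rcases Sym2.eq_iff.1 h2 with ⟨h2, -⟩ | ⟨h2, -⟩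
      · have := hb.eq_of_eq (by omega) (by omega) h2
        omega
      · have := hb.eq_of_eq (by omega) (by omega) h2
        omega
  have hfix : ∀ i < l, φ (b i) = b i ∧ φ (b (i + 1)) = b (i + 1) := by
    intro i
    induction i with
    | zero => exact fun _ => h01
    | succ i ih =>
      intro hi
      obtain ⟨h0, h1⟩ := ih (by omega)
      refine ⟨h1, ?_⟩
      have h2 := (hφ _ _ (hb.2 _ hi)).trans (hFstep _ hi i.succ_pos)
      rw [h1] at h2
      obtain ⟨j, hj, hj0, h2⟩ := hFy h2
      rcases Sym2.eq_iff.1 h2 with ⟨h2, h3⟩ | ⟨h2, h3⟩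
      · rw [h3, hb.eq_of_eq (by omega) (by omega) h2]
      · have hij := hb.eq_of_eq (by omega) (by omega) h2
        obtain rfl : i = j := by omega
        have := hb.eq_of_eq (by omega) (by omega) (φ.injective (h3.trans h0.symm))
        omega
  intro v
  obtain ⟨i, hi, rfl⟩ := hcover v
  rcases hi.lt_or_eq with hi | rfl
  · exact (hfix i hi).1
  · have := (hfix (i - 1) (by omega)).2
    rwa [Nat.sub_add_cancel (by omega)] at this

/-- The rigidity criterion. Here `b` is a longest path, `p` is the parent function of a search
started on that path, the label `y` marks the path, `s` is an invariant of the labeling telling the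
ends of the path apart, and `s` tells equally labelled siblings apart, except for those in `R`. -/
theorem eq_of_preserves_labeling {Λ A : Type*} {l : ℕ} {b : ℕ → V} (hb : G.IsLongestPathSeq l b)
    (hl : 2 ≤ l) {B R : Set V} (hB : ∀ v, v ∈ B ↔ ∃ i ≤ l, b i = v) {ord : V → ℕ} {p : V → V}
    (hord : Function.Injective ord)
    (hp : ∀ u ∉ B, G.Adj u (p u) ∧ ord (p u) < ord u ∧ ∀ w, G.Adj u w → ord (p u) ≤ ord w)
    (hRB : ∀ r ∈ R, r ∉ B) (hRp : ∀ u ∉ B, p u ∉ R)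
    (hR : ∀ r ∈ R, ∃ x ∉ B, x ∉ R ∧ (∀ c ∉ B, p c ≠ x) ∧ G.Adj r x ∧
      ∀ w, G.Adj x w → w ∈ R → w = r)
    {F : V → V → Λ} {y : Λ} (hFpath : ∀ i < l, F (b i) (b (i + 1)) = y)
    (hFsymm : ∀ u v, F u v = F v u)
    (hFy : ∀ u v, F u v = y → (∃ i < l, s(u, v) = s(b i, b (i + 1))) ∨
      (u ∈ R ∧ v = p u) ∨ (v ∈ R ∧ u = p v))
    {s : V → A} (hends : s (b 0) ≠ s (b l))
    (hsib : ∀ u ∉ B, u ∉ R → ∀ u' ∉ B, u' ∉ R → p u = p u' → F u (p u) = F u' (p u') →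
      s u = s u' → u = u')
    (hsibR : ∀ u ∉ B, u ∉ R → ∀ u' ∈ R, p u = p u' → F u (p u) ≠ F u' (p u'))
    (φ : G ≃g G) (hφ : ∀ u v, G.Adj u v → F (φ u) (φ v) = F u v) (hs : ∀ v, s (φ v) = s v)
    (v : V) : φ v = v := by
  have hpath : ∀ i < l, F (φ (b i)) (φ (b (i + 1))) = y := fun i hi =>
    (hφ _ _ (hb.1.2 i hi)).trans (hFpath i hi)
  have hyB : ∀ {u w i}, i < l → s(u, w) = s(b i, b (i + 1)) → u ∈ B ∧ w ∈ B := by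
    intro u w i hi h
    rcases Sym2.eq_iff.1 h with ⟨rfl, rfl⟩ | ⟨rfl, rfl⟩
    · exact ⟨(hB _).2 ⟨i, hi.le, rfl⟩, (hB _).2 ⟨i + 1, hi, rfl⟩⟩
    · exact ⟨(hB _).2 ⟨i + 1, hi, rfl⟩, (hB _).2 ⟨i, hi.le, rfl⟩⟩
  have hyR : ∀ {r w}, r ∈ R → F r w = y → w = p r := by
    intro r w hr h
    rcases hFy r w h with ⟨i, hi, h⟩ | ⟨-, h⟩ | ⟨hw, h⟩
    · exact absurd (hyB hi h).1 (hRB r hr)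
    · exact h
    · exact absurd (h ▸ hr) (hRp w (hRB w hw))
  have hmark : ∀ i ≤ l, ∃ w, F (φ (b i)) w = y := by
    intro i hi
    rcases hi.lt_or_eq with hi | rfl
    · exact ⟨_, hpath i hi⟩
    · refine ⟨φ (b (i - 1)), ?_⟩
      have := hpath (i - 1) (by omega)
      rwa [Nat.sub_add_cancel (by omega), hFsymm] at this
  have hendR : ∀ r ∈ R, ¬ ∀ w, G.Adj r w → ∃ i ≤ l, φ (b i) = w := by
    intro r hr h
    obtain ⟨x, hxB, hxR, hxp, hrx, -⟩ := hR r hr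
    obtain ⟨i, hi, rfl⟩ := h x hrx
    obtain ⟨w, hw⟩ := hmark i hi
    rcases hFy _ _ hw with ⟨j, hj, h⟩ | ⟨h, -⟩ | ⟨h, h'⟩
    · exact hxB (hyB hj h).1
    · exact hxR h
    · exact hxp w (hRB w h) h'.symm
  have hbR : ∀ i ≤ l, φ (b i) ∉ R := by
    intro i hi hr
    rcases Nat.eq_zero_or_pos i with rfl | hi0
    · exact hendR _ hr fun w hw => (hb.map φ).exists_eq_of_adj_zero hw
    rcases hi.lt_or_eq with hi | rfl
    · have h1 := hyR hr (hpath i hi)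
      have h2 := hpath (i - 1) (by omega)
      rw [Nat.sub_add_cancel hi0, hFsymm] at h2
      have := hb.1.eq_of_eq (by omega) (by omega) (φ.injective (h1.trans (hyR hr h2).symm))
      omega
    · exact hendR _ hr fun w hw => (hb.map φ).exists_eq_of_adj_last hw
  have himage : ∀ i < l, ∃ j < l, s(φ (b i), φ (b (i + 1))) = s(b j, b (j + 1)) := by
    intro i hi
    rcases hFy _ _ (hpath i hi) with h | ⟨h, -⟩ | ⟨h, -⟩
    · exact h
    · exact absurd h (hbR i hi.le)
    · exact absurd h (hbR (i + 1) hi)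
  have hπ : ∀ i, ∃ j, i ≤ l → j ≤ l ∧ φ (b i) = b j := by
    intro i
    by_cases hi : i ≤ l
    · have hmem : φ (b i) ∈ B := by
        rcases hi.lt_or_eq with hi | rfl
        · obtain ⟨j, hj, h⟩ := himage i hi
          exact (hyB hj h).1
        · obtain ⟨j, hj, h⟩ := himage (i - 1) (by omega)
          rw [Nat.sub_add_cancel (by omega)] at h
          exact (hyB hj h).2
      obtain ⟨j, hj, h⟩ := (hB _).1 hmem
      exact ⟨j, fun _ => ⟨hj, h.symm⟩⟩
    · exact ⟨0, fun h => absurd h hi⟩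
  choose π hπ using hπ
  have hπinj : Set.InjOn π (Set.Iic l) := fun i hi j hj h =>
    hb.1.1 hi hj (φ.injective (((hπ i hi).2.trans (congrArg b h)).trans (hπ j hj).2.symm))
  have hπstep : ∀ i < l, π (i + 1) = π i + 1 ∨ π i = π (i + 1) + 1 := by
    intro i hi
    obtain ⟨j, hj, h⟩ := himage i hi
    obtain ⟨h1, h1'⟩ := hπ i hi.le
    obtain ⟨h2, h2'⟩ := hπ (i + 1) hi
    rw [h1', h2'] at h
    rcases Sym2.eq_iff.1 h with ⟨h3, h4⟩ | ⟨h3, h4⟩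
    · have := hb.1.eq_of_eq h1 hj.le h3
      have := hb.1.eq_of_eq h2 hj h4
      omega
    · have := hb.1.eq_of_eq h1 hj h3
      have := hb.1.eq_of_eq h2 hj.le h4
      omega
  have hfixB : ∀ u ∈ B, φ u = u := by
    rcases eq_id_or_eq_reverse_of_consecutive (fun i hi => (hπ i hi).1) hπinj hπstep with h | h
    · intro u hu
      obtain ⟨i, hi, rfl⟩ := (hB u).1 hu
      rw [(hπ i hi).2, h i hi]
    · refine absurd (hs (b 0)).symm ?_
      rwa [(hπ 0 (Nat.zero_le l)).2, h 0 (Nat.zero_le l), Nat.sub_zero]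
  have himB : ∀ u, φ u ∈ B → u ∈ B := fun u hu => by
    rwa [← φ.injective (hfixB _ hu)]
  have hfix : ∀ n, ∀ u ∉ R, ord u = n → φ u = u := by
    intro n
    induction n using Nat.strong_induction_on with
    | _ n ih =>
    rintro u huR rfl
    by_cases huB : u ∈ B
    · exact hfixB u huB
    have hu'B : φ u ∉ B := fun h => huB (himB u h)
    obtain ⟨hadj, hlt, hmin⟩ := hp u huB
    obtain ⟨hadj', -, hmin'⟩ := hp (φ u) hu'B
    have hpfix : φ (p u) = p u := ih _ hlt _ (hRp u huB) rfl
    have hadjφ : G.Adj (φ u) (p u) := by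
      rw [← hpfix]
      exact φ.map_rel_iff.2 hadj
    have hle := hmin' _ hadjφ
    have hpfix' : φ (p (φ u)) = p (φ u) := ih _ (hle.trans_lt hlt) _ (hRp _ hu'B) rfl
    have hadju : G.Adj u (p (φ u)) := by
      rw [← hpfix'] at hadj'
      exact φ.map_rel_iff.1 hadj'
    have hpp : p u = p (φ u) := hord (le_antisymm (hmin _ hadju) hle)
    have hF : F u (p u) = F (φ u) (p (φ u)) := by
      rw [← hpp, ← hφ _ _ hadj, hpfix]
    by_cases hu'R : φ u ∈ R
    · exact absurd hF (hsibR u huB huR _ hu'R hpp)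
    · exact (hsib u huB huR _ hu'B hu'R hpp hF (hs u).symm).symm
  by_cases hvR : v ∈ R
  · obtain ⟨x, -, hxR, -, hvx, hx⟩ := hR v hvR
    by_contra hne
    have hadj : G.Adj x (φ v) := by
      rw [← hfix _ x hxR rfl]
      exact φ.map_rel_iff.2 hvx.symm
    exact hne (φ.injective (hfix _ _ (fun h => hne (hx _ hadj h)) rfl))
  · exact hfix _ v hvR rfl

end SimpleGraph

namespace SimpleGraph

variable {V : Type*} {G : SimpleGraph V}

/-- A connected graph with minimum degree at least two and all degrees at most `k ^ 2` has a
distinguishing labeling with `k + 1` labels. -/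
theorem distinguishingIndex_le_of_degree_le [Fintype V] [DecidableRel G.Adj]
    (hconn : G.Connected) (hδ : 2 ≤ G.minDegree) {k : ℕ} (hk : 2 ≤ k)
    (hΔ : ∀ v, G.degree v ≤ k ^ 2) : G.distinguishingIndex ≤ k + 1 := by
  classical
  have : NeZero k := ⟨by omega⟩
  have : Fact (1 < k) := ⟨by omega⟩
  have : Nonempty V := hconn.nonempty
  have hΛ : Fintype.card (Option (ZMod k)) = k + 1 := by rw [Fintype.card_option, ZMod.card]
  rw [← hΛ]
  obtain ⟨l, b, hb⟩ := exists_isLongestPathSeq G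
  have hl := hb.two_le hδ
  by_cases hcover : ∀ v, ∃ i ≤ l, b i = v
  · exact distinguishingIndex_le_card_of_hamiltonian hb.1 hl hcover
      (x := some 1) (y := none) (z := some 0) (by simp) (by simp) (by simp)
  push Not at hcover
  obtain ⟨v₀, hv₀⟩ := hcover
  obtain ⟨j, hj, hadj, hj1, hjl⟩ := hb.exists_chord hconn hδ hv₀
  obtain ⟨B, hB⟩ : ∃ B : Finset V, ∀ v, v ∈ B ↔ ∃ i ≤ l, b i = v :=
    ⟨(Finset.Iic l).image b, by simp⟩
  have hbB : ∀ i ≤ l, b i ∈ B := fun i hi => (hB _).2 ⟨i, hi, rfl⟩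
  obtain ⟨ord, p, hord, hp⟩ := exists_parent hconn (b 0)
  have hp : ∀ u ∉ B, G.Adj u (p u) ∧ ord (p u) < ord u ∧ ∀ w, G.Adj u w → ord (p u) ≤ ord w :=
    fun u hu => hp u fun h => hu (h ▸ hbB 0 (Nat.zero_le l))
  obtain ⟨N, hN⟩ : ∃ N : V → Finset V, ∀ v u, u ∈ N v ↔ u ∉ B ∧ p u = v :=
    ⟨fun v => {u | u ∉ B ∧ p u = v}, by simp⟩
  have hNadj : ∀ {v u}, u ∈ N v → G.Adj v u := by
    intro v u hu
    obtain ⟨huB, rfl⟩ := (hN v u).1 hu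
    exact (hp u huB).1.symm
  have hNasymm : ∀ {v u}, u ∈ N v → v ∉ N u := by
    intro v u hu hv
    obtain ⟨huB, rfl⟩ := (hN v u).1 hu
    obtain ⟨hvB, h⟩ := (hN u _).1 hv
    have := (hp _ hvB).2.1
    rw [h] at this
    exact this.asymm (hp u huB).2.1
  have hNcard : ∀ v, (N v).card < k ^ 2 := by
    intro v
    refine lt_of_lt_of_le ?_ (hΔ v)
    rw [← G.card_neighborFinset_eq_degree]
    refine Finset.card_lt_card ((Finset.ssubset_iff_of_subset fun u hu => ?_).2 ?_)
    · simpa using hNadj hu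
    · by_cases hv : v ∈ B
      · obtain ⟨i, hi, rfl⟩ := (hB v).1 hv
        rcases hi.lt_or_eq with hi | rfl
        · exact ⟨b (i + 1), by simpa using hb.1.2 i hi, fun h => ((hN _ _).1 h).1 (hbB _ hi)⟩
        · refine ⟨b (i - 1), ?_, fun h => ((hN _ _).1 h).1 (hbB _ (by omega))⟩
          have := hb.1.2 (i - 1) (by omega)
          rw [Nat.sub_add_cancel (by omega)] at this
          simpa using this.symm
      · exact ⟨p v, by simpa using (hp v hv).1, hNasymm ((hN _ _).2 ⟨hv, rfl⟩)⟩
  obtain ⟨L, hL⟩ : ∃ L : Finset V, ∀ u, u ∈ L ↔ u ∉ B ∧ N u = ∅ :=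
    ⟨({u | u ∉ B ∧ N u = ∅} : Finset V), by simp⟩
  have hpL : ∀ u ∉ B, p u ∉ L := by
    intro u hu h
    exact Finset.notMem_empty u (((hL _).1 h).2 ▸ (hN _ _).2 ⟨hu, rfl⟩)
  obtain ⟨R, hRL, hleave, hR⟩ := exists_discarded_set (G := G) L p
    (fun u hu => hpL u ((hL u).1 hu).1) (fun u _ => by
      have hcard : 1 < (G.neighborFinset u).card := by
        rw [G.card_neighborFinset_eq_degree]
        exact hδ.trans (G.minDegree_le_degree u)
      obtain ⟨w, hw, hne⟩ := Finset.exists_mem_ne hcard (p u)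
      exact ⟨w, by simpa using hw, hne⟩)
  choose t ht using fun v => exists_second_label_sdiff hk (N v) R (hNcard v)
  let H : SimpleGraph V :=
    { Adj := fun u w => G.Adj u w ∧ u ∉ N w ∧ w ∉ N u
      symm := ⟨fun u w h => ⟨h.1.symm, h.2.2, h.2.1⟩⟩
      loopless := ⟨fun u h => G.irrefl h.1⟩ }
  have hH : ∀ {u w}, H.Adj u w ↔ G.Adj u w ∧ u ∉ N w ∧ w ∉ N u := Iff.rfl
  obtain ⟨g, hg⟩ := exists_edge_weight H (fun u => t (p u) u) (L \ R) (fun T hT hne => by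
    obtain ⟨u, hu, w, hw, huw, hwp⟩ := hleave T hT hne
    have huL := (hL u).1 (Finset.mem_sdiff.1 (hT hu)).1
    refine ⟨u, hu, w, hw, hH.2 ⟨huw, fun h => hwp ((hN _ _).1 h).2.symm, ?_⟩⟩
    rw [huL.2]
    exact Finset.notMem_empty w)
  choose a hasum hanone hainj haR using
    fun v => ht v (t (p v) v - ∑ w ∈ H.neighborFinset v, g s(v, w))
  let F : V → V → Option (ZMod k) := fun u v =>
    if u ∈ B ∧ v ∈ B then
      if ∃ i < l, s(u, v) = s(b i, b (i + 1)) then none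
      else if s(u, v) = s(b 0, b j) then some 1 else some 0
    else if u ∈ N v then a v u else if v ∈ N u then a u v else some (g s(u, v))
  have hFsymm : ∀ u v, F u v = F v u := by
    intro u v
    simp only [F, Sym2.eq_swap (a := u) (b := v), and_comm (a := u ∈ B)]
    split_ifs <;> first | rfl | contradiction | exact absurd ‹_› (hNasymm ‹_›)
  have hFB : ∀ {u v}, u ∈ B → v ∈ B → F u v = if ∃ i < l, s(u, v) = s(b i, b (i + 1)) then none
      else if s(u, v) = s(b 0, b j) then some 1 else some 0 := fun hu hv => if_pos ⟨hu, hv⟩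
  have hFN : ∀ {u v}, u ∈ N v → F u v = a v u := by
    intro u v h
    have : ¬ (u ∈ B ∧ v ∈ B) := fun h' => ((hN _ _).1 h).1 h'.1
    simp only [F, this, h, if_true, if_false]
  have hFH : ∀ {u v}, u ∉ B → H.Adj u v → F u v = some (g s(u, v)) := by
    intro u v hu h
    have hH := hH.1 h
    simp only [F, hu, hH.2.1, hH.2.2, false_and, if_false]
  have hFp : ∀ {u}, u ∉ B → F u (p u) = a (p u) u := fun hu => hFN ((hN _ _).2 ⟨hu, rfl⟩)
  have hFpath : ∀ i < l, F (b i) (b (i + 1)) = none := by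
    intro i hi
    rw [hFB (hbB i hi.le) (hbB _ hi)]
    exact if_pos ⟨i, hi, rfl⟩
  have haRnone : ∀ {u v}, u ∈ N v → a v u = none → u ∈ R ∧ v = p u := by
    intro u v hu h
    refine ⟨?_, ((hN _ _).1 hu).2.symm⟩
    by_contra huR
    exact hanone v u hu huR h
  have hFnone : ∀ u v, F u v = none → (∃ i < l, s(u, v) = s(b i, b (i + 1))) ∨
      (u ∈ R ∧ v = p u) ∨ (v ∈ R ∧ u = p v) := by
    intro u v h
    simp only [F] at h
    split_ifs at h with h1 h2 h3 h4 h5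
    · exact Or.inl h2
    · exact Or.inr (Or.inl (haRnone h4 h))
    · exact Or.inr (Or.inr (haRnone h5 h))
  let s : V → ZMod k := fun v => ∑ w ∈ G.neighborFinset v, (F v w).getD 0
  have hsum : ∀ u ∉ B, u ∉ R → s u = (a (p u) u).getD 0 + t (p u) u := by
    intro u hu huR
    have hnbr : G.neighborFinset u = insert (p u) (N u ∪ H.neighborFinset u) := by
      ext w
      simp only [mem_neighborFinset, Finset.mem_insert, Finset.mem_union, hH]
      constructor
      · intro h
        by_cases hw : u ∈ N w
        · exact Or.inl ((hN _ _).1 hw).2.symm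
        · tauto
      · rintro (rfl | h | h)
        · exact (hp u hu).1
        · exact hNadj h
        · exact h.1
    have hpu : u ∈ N (p u) := (hN _ _).2 ⟨hu, rfl⟩
    have hnot : p u ∉ N u ∪ H.neighborFinset u := by
      simp only [mem_neighborFinset, Finset.mem_union, hH]
      rintro (h | h)
      · exact hNasymm hpu h
      · exact h.2.1 hpu
    have hdisj : Disjoint (N u) (H.neighborFinset u) := by
      rw [Finset.disjoint_left]
      intro w hw h
      exact (hH.1 ((mem_neighborFinset _ _ _).1 h)).2.2 hw
    have hsumN : ∑ w ∈ N u, (F u w).getD 0 = ∑ w ∈ N u, (a u w).getD 0 :=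
      Finset.sum_congr rfl fun w hw => by rw [hFsymm, hFN hw]
    have hsumH : ∑ w ∈ H.neighborFinset u, (F u w).getD 0 =
        ∑ w ∈ H.neighborFinset u, g s(u, w) :=
      Finset.sum_congr rfl fun w hw => by
        rw [hFH hu ((mem_neighborFinset _ _ _).1 hw), Option.getD_some]
    simp only [s]
    rw [hnbr, Finset.sum_insert hnot, Finset.sum_union hdisj, hFp hu, hsumN, hsumH]
    congr 1
    rcases (N u).eq_empty_or_nonempty with hne | hne
    · rw [hg u (Finset.mem_sdiff.2 ⟨(hL u).2 ⟨hu, hne⟩, huR⟩), hne, Finset.sum_empty, zero_add]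
    · rw [hasum u hne, sub_add_cancel]
  have hs0 : s (b 0) = 1 := by
    have hmem : b j ∈ G.neighborFinset (b 0) := by simpa using hadj
    simp only [s]
    rw [Finset.sum_eq_single_of_mem _ hmem]
    · rw [hFB (hbB 0 (Nat.zero_le l)) (hbB j hj), if_neg, if_pos rfl, Option.getD_some]
      rintro ⟨i, hi, h⟩
      rcases Sym2.eq_iff.1 h with ⟨h1, h2⟩ | ⟨h1, -⟩
      · have := hb.1.eq_of_eq (Nat.zero_le l) hi.le h1
        have := hb.1.eq_of_eq hj hi h2
        omega
      · have := hb.1.eq_of_eq (Nat.zero_le l) hi h1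
        omega
    · intro w hw hwj
      obtain ⟨i, hi, rfl⟩ := hb.exists_eq_of_adj_zero ((mem_neighborFinset _ _ _).1 hw)
      have hne : s(b 0, b i) ≠ s(b 0, b j) := by
        rw [Ne, Sym2.congr_right]
        exact hwj
      rw [hFB (hbB 0 (Nat.zero_le l)) (hbB i hi), if_neg hne]
      split_ifs <;> rfl
  have hsl : s (b l) = 0 := by
    refine Finset.sum_eq_zero fun w hw => ?_
    obtain ⟨i, hi, rfl⟩ := hb.exists_eq_of_adj_last ((mem_neighborFinset _ _ _).1 hw)
    have hne : s(b l, b i) ≠ s(b 0, b j) := by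
      rw [Ne, Sym2.eq_iff]
      rintro (⟨h, -⟩ | ⟨h, -⟩)
      · have := hb.1.eq_of_eq le_rfl (Nat.zero_le l) h
        omega
      · exact hjl (hb.1.eq_of_eq le_rfl hj h).symm
    rw [hFB (hbB l le_rfl) (hbB i hi), if_neg hne]
    split_ifs <;> rfl
  refine distinguishingIndex_le_card F hFsymm fun φ hφ => ?_
  refine eq_of_preserves_labeling (B := B) (R := R) (s := s) hb hl hB hord hp
    (fun r hr => ((hL r).1 (hRL hr)).1) (fun u hu h => hpL u hu (hRL h)) (fun r hr => ?_)
    hFpath hFsymm hFnone (by rw [hs0, hsl]; exact one_ne_zero) ?_ ?_ φ hφ fun v => ?_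
  · obtain ⟨x, hxL, hxR, hrx, hx⟩ := hR r hr
    exact ⟨x, ((hL x).1 hxL).1, hxR, fun c hc h => hpL c hc (h ▸ hxL), hrx, hx⟩
  · intro u hu huR u' hu' huR' hpp hF hsu
    rw [hFp hu, hFp hu'] at hF
    rw [hsum u hu huR, hsum u' hu' huR', hF, add_right_inj] at hsu
    rw [← hpp] at hF hsu
    exact hainj (p u) u ((hN _ _).2 ⟨hu, rfl⟩) huR u' ((hN _ _).2 ⟨hu', hpp.symm⟩) huR' hF hsu
  · intro u hu huR r hr hpp
    have hrB := ((hL r).1 (hRL hr)).1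
    rw [hFp hu, hFp hrB, ← hpp]
    exact haR (p u) u ((hN _ _).2 ⟨hu, rfl⟩) huR r ((hN _ _).2 ⟨hrB, hpp.symm⟩) hr
  · symm
    refine Finset.sum_bij' (fun w _ => φ w) (fun w _ => φ.symm w) ?_ ?_ ?_ ?_ ?_
    · intro w hw
      rw [mem_neighborFinset] at hw ⊢
      exact φ.map_rel_iff.2 hw
    · intro w hw
      rw [mem_neighborFinset] at hw ⊢
      rwa [← φ.map_rel_iff, φ.apply_symm_apply]
    · simp
    · simp
    · intro w hw
      rw [hφ v w ((mem_neighborFinset _ _ _).1 hw)]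

end SimpleGraph

theorem distinguishingIndex_le_ceil_sqrt_maxDegree_add_one
    {V : Type*} [Fintype V] (G : SimpleGraph V) [DecidableRel G.Adj]
    (hconn : G.Connected) (hδ : 2 ≤ G.minDegree) :
    G.distinguishingIndex ≤ ⌈Real.sqrt (G.maxDegree : ℝ)⌉₊ + 1 := by
  have hsq : G.maxDegree ≤ ⌈Real.sqrt (G.maxDegree : ℝ)⌉₊ ^ 2 := by
    have h := (Real.sqrt_le_left (Nat.cast_nonneg _)).1 (Nat.le_ceil (Real.sqrt G.maxDegree))
    exact_mod_cast h
  obtain ⟨v⟩ := hconn.nonempty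
  have hΔ : 2 ≤ G.maxDegree :=
    (hδ.trans (G.minDegree_le_degree v)).trans (G.degree_le_maxDegree v)
  refine SimpleGraph.distinguishingIndex_le_of_degree_le hconn hδ ?_
    fun v => (G.degree_le_maxDegree v).trans hsq
  by_contra! h
  have := Nat.pow_le_pow_left (Nat.le_of_lt_succ h) 2
  omega
end
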